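/- Let C be a characteristic cyclic subgroup of maximal order in a finite solvable group G. Then β(G) ≤ |C|^{0.1} · |G|^{0.9}. -/

import Mathlib

/-!  Definition of the Noether number `β(G)` of a group `G`, over the field `ℂ`
(of characteristic 0).  A finite-dimensional `ℂG`-module is (up to isomorphism)
given by a representation `ρ : Representation ℂ G (Fin n → ℂ)`; the algebra of
polynomial invariants is realised inside `MvPolynomial (Fin n) ℂ` as the
common equalizer of the substitution maps induced by the group elements. -/

/-- The algebra endomorphism of the polynomial ring induced by the linear action of
`g : G` on the underlying space (substitution of the variables by linear forms). -/
noncomputable def Representation.polySubst {G : Type*} [Group G] {n : ℕ}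
    (ρ : Representation ℂ G (Fin n → ℂ)) (g : G) :
    MvPolynomial (Fin n) ℂ →ₐ[ℂ] MvPolynomial (Fin n) ℂ :=
  MvPolynomial.aeval fun i =>
    ∑ j, MvPolynomial.C (LinearMap.toMatrix' (ρ g) i j) * MvPolynomial.X j

/-- The subalgebra of `G`-invariant polynomials. -/
noncomputable def Representation.invariantAlgebra {G : Type*} [Group G] {n : ℕ}
    (ρ : Representation ℂ G (Fin n → ℂ)) : Subalgebra ℂ (MvPolynomial (Fin n) ℂ) :=
  ⨅ g : G, AlgHom.equalizer (ρ.polySubst g) (AlgHom.id ℂ (MvPolynomial (Fin n) ℂ))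

/-- The invariant algebra is generated by its elements of (total) degree at most `d`. -/
def Representation.InvariantsGeneratedInDegree {G : Type*} [Group G] {n : ℕ}
    (ρ : Representation ℂ G (Fin n → ℂ)) (d : ℕ) : Prop :=
  Algebra.adjoin ℂ {f : MvPolynomial (Fin n) ℂ | f ∈ ρ.invariantAlgebra ∧ f.totalDegree ≤ d}
    = ρ.invariantAlgebra

/-- The Noether number `β(G)`: the smallest degree bound `d` such that for every
finite-dimensional `ℂG`-module the algebra of polynomial invariants is generated
by its elements of degree at most `d`.  (Equivalently, the maximum over all
finite-dimensional modules `V` of the minimal generating degree `β(G,V)`.) -/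
noncomputable def noetherNumber (G : Type*) [Group G] : ℕ :=
  sInf {d : ℕ | ∀ (n : ℕ) (ρ : Representation ℂ G (Fin n → ℂ)),
    ρ.InvariantsGeneratedInDegree d}

/-- The Noether index `n(G) = |G| / β(G)`, as a real number. -/
noncomputable def noetherIndex (G : Type*) [Group G] : ℝ :=
  (Nat.card G : ℝ) / (noetherNumber G : ℝ)

namespace NoetherBound

open Finset

/-- If all sums of `Φ` over simultaneous left translations of a nonempty set of coordinates
vanish, then `Φ` vanishes at the identity tuple. -/
theorem eq_zero_of_translate_sums {H N : Type*} [Group H] [Fintype H] [DecidableEq H]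
    [AddCommGroup N] [Module ℂ N] (Φ : (H → H) → N)
    (hΦ : ∀ (y : H → H) (T : Finset H), T.Nonempty →
      ∑ h, Φ (fun η => if η ∈ T then h * y η else y η) = 0) : Φ 1 = 0 := by
  set F : H → Finset H → N := fun h T =>
    ((-1 : ℂ) ^ #T) • Φ (fun η => if η ∈ T then h * η else 1) with hF
  have h1 : ∀ h, ∑ T : Finset H, F h T = 0 := by
    intro h
    refine Finset.sum_involution (fun T _ => if h⁻¹ ∈ T then T.erase h⁻¹ else insert h⁻¹ T)
      ?_ ?_ (fun _ _ => mem_univ _) ?_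
    · intro T _
      have key : ∀ U : Finset H, h⁻¹ ∉ U → F h (insert h⁻¹ U) = - F h U := by
        intro U hU
        simp only [hF, card_insert_of_notMem hU, pow_succ]
        rw [mul_neg_one, neg_smul]
        congr 3
        funext η
        by_cases hη : η = h⁻¹
        · subst hη; simp [hU]
        · simp [hη]
      split_ifs with hT
      · have := key (T.erase h⁻¹) (by simp)
        rw [insert_erase hT] at this
        rw [this]; simp
      · rw [key T hT]; simp
    · intro T _ _ heq
      split_ifs at heq with hT
      · exact absurd hT (by rw [← heq]; simp)
      · exact hT (by rw [← heq]; simp)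
    · intro T _
      by_cases hT : h⁻¹ ∈ T
      · simp [hT]
      · simp [hT]
  have h2 : ∑ T : Finset H, ∑ h, F h T = 0 := by
    rw [Finset.sum_comm]; exact Finset.sum_eq_zero fun h _ => h1 h
  rw [Finset.sum_eq_single ∅] at h2
  · simp only [hF] at h2
    simp only [card_empty, pow_zero, notMem_empty, if_false, one_smul, sum_const, card_univ] at h2
    rw [← Nat.cast_smul_eq_nsmul ℂ] at h2
    have h3 : (Fintype.card H : ℂ) ≠ 0 := by simp
    exact (smul_eq_zero.1 h2).resolve_left h3
  · intro T _ hT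
    have := hΦ (fun η => if η ∈ T then η else 1) T (nonempty_iff_ne_empty.2 hT)
    rw [← smul_zero ((-1 : ℂ) ^ #T), ← this, Finset.smul_sum]
    refine Finset.sum_congr rfl fun h _ => ?_
    simp only [hF]
    congr 2
    funext η
    split_ifs <;> rfl
  · simp

open scoped Classical Pointwise in
/-- Tuples with few distinct entries can be rewritten, modulo translation relations, in terms of
tuples with more than `c` distinct entries, as soon as there are more than `c ^ 3` coordinates. -/
theorem eq_zero_of_translate_relations {B N ι : Type*} [Group B] [Fintype B] [AddCommGroup N]
    [Module ℂ N] (θ : (ι → B) → N) (c : ℕ) : ∀ (E : Finset ι), c ^ 3 + 1 ≤ #E →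
    (∀ S ⊆ E, S.Nonempty → ∀ x : ι → B, ∑ h, θ (fun i => if i ∈ S then h * x i else x i) = 0) →
    ∀ x, (∀ x', (∀ i ∉ E, x' i = x i) → c < #(E.image x') → θ x' = 0) → θ x = 0 := by
  induction c with
  | zero =>
    intro E hE _ x hx
    refine hx x (fun _ _ => rfl) ?_
    rw [card_pos, image_nonempty, ← card_pos]
    omega
  | succ c ih =>
    intro E hE hrel x₀ hx₀
    refine ih E (le_trans (by gcongr; omega) hE) hrel x₀ fun x hx hxc => ?_
    by_cases hxc' : c + 1 < #(E.image x)
    · exact hx₀ x hx hxc'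
    set Y := E.image x with hY
    have hYc : #Y = c + 1 := by omega
    set H := MulAction.stabilizer B Y with hH
    have hHc : Fintype.card H ≤ c + 1 := by
      rw [← hYc]
      obtain ⟨y, hy⟩ : Y.Nonempty := by rw [← card_pos]; omega
      rw [← Finset.card_univ]
      refine card_le_card_of_injOn (fun h : H => (h : B) * y) ?_ ?_
      · intro h _
        have h1 : (h : B) • Y = Y := h.2
        rw [← h1]
        exact smul_mem_smul_finset hy
      · intro a _ b _ hab
        exact Subtype.ext (mul_right_cancel hab)
    have inner : ∀ n t, t + n = Fintype.card H → ∀ (A : ℕ → Finset ι) (x : ι → B),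
        (∀ i ∉ E, x i = x₀ i) → (∀ i ≤ t, A i ⊆ E ∧ #(A i) = c + 1 ∧ (A i).image x = Y) →
        (∀ i ≤ t, ∀ j < i, Disjoint (A i) (A j)) → θ x = 0 := by
      intro n
      induction n with
      | zero =>
        intro t ht A x hx hA hdis
        let e : H ≃ Fin (Fintype.card H) := Fintype.equivFin H
        have hle : ∀ η : H, (e η : ℕ) + 1 ≤ t := fun η => by have := (e η).2; omega
        have hdis' : ∀ i ≤ t, ∀ j ≤ t, i ≠ j → Disjoint (A i) (A j) := by
          intro i hi j hj hij
          rcases lt_or_gt_of_ne hij with h | h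
          · exact (hdis j hj i h).symm
          · exact hdis i hi j h
        let g : (H → H) → ι → B := fun y i =>
          if hi : ∃ η : H, i ∈ A (e η + 1) then ((y hi.choose : H) : B) * x i else x i
        have hg : ∀ y η i, i ∈ A (e η + 1) → g y i = (y η : B) * x i := by
          intro y η i hi
          have hex : ∃ η : H, i ∈ A (e η + 1) := ⟨η, hi⟩
          have : hex.choose = η := by
            by_contra hne
            have h1 := hdis' _ (hle hex.choose) _ (hle η) (by
              intro h
              exact hne (e.injective (Fin.ext (by omega))))
            exact (Finset.disjoint_left.1 h1) hex.choose_spec hi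
          simp only [g, dif_pos hex, this]
        have hg' : ∀ y i, (∀ η : H, i ∉ A (e η + 1)) → g y i = x i := by
          intro y i hi
          have : ¬ ∃ η : H, i ∈ A (e η + 1) := by push Not; exact hi
          simp only [g, dif_neg this]
        have := eq_zero_of_translate_sums (fun y => θ (g y)) ?_
        · rw [← this]
          congr 1
          funext i
          by_cases hi : ∃ η : H, i ∈ A (e η + 1)
          · obtain ⟨η, hη⟩ := hi
            rw [hg _ η i hη]; simp
          · rw [hg' _ i (by push Not at hi; exact hi)]
        · intro y T hT
          set S := T.biUnion fun η => A (e η + 1) with hS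
          have hSE : S ⊆ E := by
            intro i hi
            simp only [hS, mem_biUnion] at hi
            obtain ⟨η, _, hη⟩ := hi
            exact (hA _ (hle η)).1 hη
          have hSne : S.Nonempty := by
            obtain ⟨η, hη⟩ := hT
            have h1 := (hA _ (hle η)).2.1
            have : (A (e η + 1)).Nonempty := by rw [← card_pos]; omega
            obtain ⟨i, hi⟩ := this
            exact ⟨i, mem_biUnion.2 ⟨η, hη, hi⟩⟩
          have hrel' := hrel S hSE hSne (g y)
          rw [← Fintype.sum_subtype_add_sum_subtype (fun h => h ∈ H)] at hrel'
          rw [Finset.sum_eq_zero (s := (univ : Finset {h // h ∉ H})), add_zero] at hrel'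
          · rw [← hrel']
            refine Finset.sum_congr rfl fun h _ => ?_
            congr 1
            funext i
            by_cases hi : ∃ η : H, i ∈ A (e η + 1)
            · obtain ⟨η, hη⟩ := hi
              have hmem : i ∈ S ↔ η ∈ T := by
                constructor
                · intro hiS
                  obtain ⟨η', hη', hi'⟩ := mem_biUnion.1 hiS
                  by_contra hne
                  have h1 := hdis' _ (hle η') _ (hle η) (by
                    intro h
                    have : η' = η := e.injective (Fin.ext (by omega))
                    exact hne (this ▸ hη'))
                  exact (Finset.disjoint_left.1 h1) hi' hη
                · intro h; exact mem_biUnion.2 ⟨η, h, hη⟩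
              refine (hg (fun η => if η ∈ T then h * y η else y η) η i hη).trans ?_
              rw [hg y η i hη]
              simp only [hmem]
              split_ifs
              · simp [mul_assoc]
              · rfl
            · push Not at hi
              have hmem : i ∉ S := by
                intro hiS
                obtain ⟨η', hη', hi'⟩ := mem_biUnion.1 hiS
                exact hi η' hi'
              refine (hg' (fun η => if η ∈ T then h * y η else y η) i hi).trans ?_
              rw [if_neg hmem, hg' y i hi]
          · rintro ⟨h, hh⟩ _
            refine hx₀ _ ?_ ?_
            · intro i hi
              rw [if_neg (fun h => hi (hSE h)), hg' _ i (fun η h => hi ((hA _ (hle η)).1 h)),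
                hx i hi]
            · set z : ι → B := fun i => if i ∈ S then h * g y i else g y i with hz
              have hYsub : Y ⊆ E.image z := by
                rw [← (hA 0 (Nat.zero_le _)).2.2]
                intro b hb
                obtain ⟨i, hi, rfl⟩ := mem_image.1 hb
                have hi' : ∀ η : H, i ∉ A (e η + 1) := fun η h =>
                  (Finset.disjoint_left.1 (hdis' 0 (Nat.zero_le _) _ (hle η) (by omega))) hi h
                refine mem_image.2 ⟨i, (hA 0 (Nat.zero_le _)).1 hi, ?_⟩
                have hmem : i ∉ S := by
                  intro hiS
                  obtain ⟨η', hη', hi''⟩ := mem_biUnion.1 hiS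
                  exact hi' η' hi''
                simp only [hz, if_neg hmem, hg' y i hi']
              have hYsub' : h • Y ⊆ E.image z := by
                obtain ⟨η, hη⟩ := hT
                intro b hb
                obtain ⟨a, ha, rfl⟩ := mem_smul_finset.1 hb
                have h1 : (y η : B) • Y = Y := (y η).2
                rw [← h1, ← (hA _ (hle η)).2.2] at ha
                obtain ⟨a', ha', rfl⟩ := mem_smul_finset.1 ha
                obtain ⟨i, hi, rfl⟩ := mem_image.1 ha'
                refine mem_image.2 ⟨i, (hA _ (hle η)).1 hi, ?_⟩
                have hmem : i ∈ S := mem_biUnion.2 ⟨η, hη, hi⟩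
                simp only [hz, if_pos hmem, hg y η i hi, smul_eq_mul]
              have hne : ¬ (h • Y ⊆ Y) := by
                intro hsub
                exact hh (Finset.eq_of_subset_of_card_le hsub (by simp))
              have hlt : Y ⊂ E.image z := by
                refine hYsub.ssubset_of_ne fun heq => hne ?_
                rw [heq] at hYsub' ⊢
                convert hYsub'
              have := card_lt_card hlt
              omega
      | succ n ihn =>
        intro t ht A x hx hA hdis
        set U := (range (t + 1)).biUnion A with hU
        have hUE : U ⊆ E := by
          intro i hi
          obtain ⟨j, hj, hij⟩ := mem_biUnion.1 hi
          exact (hA j (by simpa [Nat.lt_succ_iff] using hj)).1 hij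
        have hUc : #U ≤ (t + 1) * (c + 1) := by
          refine card_biUnion_le.trans ?_
          rw [Finset.sum_congr rfl fun j hj =>
            (hA j (by simpa [Nat.lt_succ_iff] using hj)).2.1]
          simp
        have hUc' : #U ≤ (c + 1) * (c + 1) := hUc.trans (by gcongr; omega)
        refine ih (E \ U) ?_ (fun S hS => hrel S (hS.trans sdiff_subset)) x ?_
        · rw [card_sdiff_of_subset hUE]
          have : c ^ 3 + 1 + (c + 1) * (c + 1) ≤ #E := le_trans (by ring_nf; nlinarith) hE
          omega
        · intro x' hx' hc'
          have hxE : ∀ i ∉ E, x' i = x₀ i := fun i hi => by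
            rw [hx' i (fun h => hi (mem_sdiff.1 h).1), hx i hi]
          have hA' : ∀ i ≤ t, (A i).image x' = Y := by
            intro i hi
            rw [← (hA i hi).2.2]
            refine image_congr fun j hj => hx' j fun h => (mem_sdiff.1 h).2 ?_
            exact mem_biUnion.2 ⟨i, by simpa [Nat.lt_succ_iff] using hi, hj⟩
          have hYsub : Y ⊆ E.image x' := by
            rw [← hA' 0 (Nat.zero_le _)]
            exact image_subset_image (hA 0 (Nat.zero_le _)).1
          by_cases hbig : c + 1 < #(E.image x')
          · exact hx₀ x' hxE hbig
          have hYeq : Y = E.image x' := Finset.eq_of_subset_of_card_le hYsub (by omega)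
          have hYeq' : (E \ U).image x' = Y := by
            refine Finset.eq_of_subset_of_card_le ?_ (by omega)
            rw [hYeq]
            exact image_subset_image sdiff_subset
          obtain ⟨W, hW', hWinj, hWim⟩ :=
            Finset.exists_subset_injOn_image_eq_of_surjOn (f := x') (E \ U) Y (by
              rw [← hYeq']; simp [Set.surjOn_image])
          have hW : W ⊆ E \ U := by exact_mod_cast hW'
          refine ihn (t + 1) (by omega) (fun i => if i ≤ t then A i else W) x' hxE ?_ ?_
          · intro i hi
            by_cases hit : i ≤ t
            · simp only [hit, if_true]
              exact ⟨(hA i hit).1, (hA i hit).2.1, hA' i hit⟩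
            · simp only [hit, if_false]
              exact ⟨hW.trans sdiff_subset, by
                rw [← hYc, ← hWim, card_image_of_injOn hWinj], hWim⟩
          · intro i hi j hj
            have hjt : j ≤ t := by omega
            by_cases hit : i ≤ t
            · simp only [hit, hjt, if_true]
              exact hdis i hit j hj
            · simp only [hit, hjt, if_true, if_false]
              refine Finset.disjoint_left.2 fun a ha ha' => (mem_sdiff.1 (hW ha)).2 ?_
              exact mem_biUnion.2 ⟨j, by simpa [Nat.lt_succ_iff] using hjt, ha'⟩
    obtain ⟨W, hW, hWinj, hWim⟩ :=
      Finset.exists_subset_injOn_image_eq_of_surjOn (f := x) E Y (by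
        rw [hY]; simp [Set.surjOn_image])
    refine inner (Fintype.card H) 0 (by simp) (fun _ => W) x hx ?_ ?_
    · intro i _
      exact ⟨hW, by rw [← hYc, ← hWim, card_image_of_injOn hWinj], hWim⟩
    · intro i hi j hj; omega

open scoped Classical Pointwise in
/-- The number of sums of at most `h` terms of a sequence over `ZMod p` without short zero-sums. -/
theorem card_short_sums_ge {p : ℕ} [Fact p.Prime] {ι : Type*} (c : ι → ZMod p) (h : ℕ) :
    ∀ U : Finset ι, (∀ S ⊆ U, S.Nonempty → #S ≤ h → ∑ i ∈ S, c i ≠ 0) →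
    min p (∑ v, min #{i ∈ U | c i = v} h) ≤
      #({S ∈ U.powerset | S.Nonempty ∧ #S ≤ h}.image fun S => ∑ i ∈ S, c i) := by
  induction h with
  | zero => intro U _; simp
  | succ h ih =>
    intro U hU
    rcases U.eq_empty_or_nonempty with rfl | hne
    · simp
    obtain ⟨T, hT', hTinj, hTim⟩ :=
      Finset.exists_subset_injOn_image_eq_of_surjOn (f := c) (U : Set ι) (U.image c) (by
        simp [Set.surjOn_image])
    have hT : T ⊆ U := by exact_mod_cast hT'
    have ih' := ih (U \ T) fun S hS hSne hSc =>
      hU S (hS.trans sdiff_subset) hSne (by omega)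
    set N := {S ∈ (U \ T).powerset | S.Nonempty ∧ #S ≤ h}.image fun S => ∑ i ∈ S, c i with hN
    have h0 : (0 : ZMod p) ∉ N := by
      intro h0
      obtain ⟨S, hS, hS0⟩ := mem_image.1 h0
      rw [mem_filter, mem_powerset] at hS
      exact hU S (hS.1.trans sdiff_subset) hS.2.1 (by omega) hS0
    have hcd := ZMod.cauchy_davenport (p := p) Fact.out (s := U.image c) (t := insert 0 N)
      (by simpa using hne) (insert_nonempty _ _)
    rw [card_insert_of_notMem h0] at hcd
    have hsub : U.image c + insert 0 N ⊆
        {S ∈ U.powerset | S.Nonempty ∧ #S ≤ h + 1}.image fun S => ∑ i ∈ S, c i := by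
      intro z hz
      obtain ⟨a, ha, b, hb, rfl⟩ := mem_add.1 hz
      rw [← hTim] at ha
      obtain ⟨i, hi, rfl⟩ := mem_image.1 ha
      rw [mem_insert] at hb
      rw [mem_image]
      rcases hb with rfl | hb
      · exact ⟨{i}, by simp [hT hi], by simp⟩
      · obtain ⟨S, hS, rfl⟩ := mem_image.1 hb
        rw [mem_filter, mem_powerset] at hS
        have hiS : i ∉ S := fun h => (mem_sdiff.1 (hS.1 h)).2 hi
        refine ⟨insert i S, ?_, by simp [sum_insert hiS]⟩
        rw [mem_filter, mem_powerset]
        refine ⟨insert_subset (hT hi) (hS.1.trans sdiff_subset), insert_nonempty _ _, ?_⟩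
        rw [card_insert_of_notMem hiS]; omega
    refine le_trans ?_ (card_le_card hsub)
    refine le_trans ?_ hcd
    have hsum : ∑ v, min #{i ∈ U | c i = v} (h + 1) ≤
        #(U.image c) + ∑ v, min #{i ∈ U \ T | c i = v} h := by
      have h1 : #(U.image c) = ∑ v : ZMod p, if v ∈ U.image c then 1 else 0 := by
        rw [sum_ite_mem, univ_inter, card_eq_sum_ones]
      rw [h1, ← sum_add_distrib]
      refine sum_le_sum fun v _ => ?_
      by_cases hv : v ∈ U.image c
      · rw [if_pos hv]
        have h2 : #{i ∈ U | c i = v} ≤ #{i ∈ U \ T | c i = v} + 1 := by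
          have h3 : #{i ∈ T | c i = v} ≤ 1 := by
            rw [card_le_one]
            intro a ha b hb
            rw [mem_filter] at ha hb
            exact hTinj ha.1 hb.1 (ha.2.trans hb.2.symm)
          have h4 : {i ∈ U | c i = v} ⊆ {i ∈ U \ T | c i = v} ∪ {i ∈ T | c i = v} := by
            intro i hi
            simp only [mem_filter, mem_union, mem_sdiff] at hi ⊢
            tauto
          exact ((card_le_card h4).trans (card_union_le _ _)).trans (by omega)
        omega
      · have : {i ∈ U | c i = v} = ∅ := by
          rw [filter_eq_empty_iff]
          rintro i hi rfl
          exact hv (mem_image_of_mem _ hi)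
        simp [this]
    omega

open scoped Classical in
theorem exists_short_zero_sum {p : ℕ} [Fact p.Prime] {ι : Type*} (c : ι → ZMod p) (h : ℕ)
    (U : Finset ι) (hp : p ≤ ∑ v, min #{i ∈ U | c i = v} h) :
    ∃ S ⊆ U, S.Nonempty ∧ #S ≤ h ∧ ∑ i ∈ S, c i = 0 := by
  by_contra! hcon
  have h1 := card_short_sums_ge c h U hcon
  rw [min_eq_left hp] at h1
  have h2 : #({S ∈ U.powerset | S.Nonempty ∧ #S ≤ h}.image fun S => ∑ i ∈ S, c i) <
      #(univ : Finset (ZMod p)) := by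
    refine card_lt_card (ssubset_univ_iff.2 fun heq => ?_)
    have h0 := heq ▸ mem_univ (0 : ZMod p)
    obtain ⟨S, hS, hS0⟩ := mem_image.1 h0
    rw [mem_filter, mem_powerset] at hS
    exact hcon S hS.1 hS.2.1 hS.2.2 hS0
  rw [card_univ, ZMod.card] at h2
  omega

theorem prod_le_of_forall_prod_mem {R ι : Type*} [CommRing R] [Algebra ℂ R]
    (M : ι → Submodule ℂ R) (S : Finset ι) : ∀ N : Submodule ℂ R,
    (∀ v : ι → R, (∀ i ∈ S, v i ∈ M i) → ∏ i ∈ S, v i ∈ N) → ∏ i ∈ S, M i ≤ N := by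
  classical
  induction S using Finset.induction_on with
  | empty =>
    intro N h
    rw [prod_empty, Submodule.one_le]
    simpa using h 0 (by simp)
  | insert a S ha ih =>
    intro N h
    rw [prod_insert ha, Submodule.mul_le]
    intro x hx y hy
    refine ih (N.comap (LinearMap.mulLeft ℂ x)) (fun v hv => ?_) hy
    have := h (fun i => if i = a then x else v i) (by
      intro i hi
      by_cases hia : i = a
      · subst hia; simpa using hx
      · simpa [hia] using hv i (by simpa [hia] using hi))
    rw [prod_insert ha] at this
    have h2 : ∏ i ∈ S, (if i = a then x else v i) = ∏ i ∈ S, v i := by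
      refine prod_congr rfl fun i hi => ?_
      rw [if_neg]
      rintro rfl
      exact ha hi
    simpa [h2] using this

theorem prod_mem_prod {R ι : Type*} [CommRing R] [Algebra ℂ R]
    (M : ι → Submodule ℂ R) (S : Finset ι) (v : ι → R) (hv : ∀ i ∈ S, v i ∈ M i) :
    ∏ i ∈ S, v i ∈ ∏ i ∈ S, M i := by
  classical
  induction S using Finset.induction_on with
  | empty => simpa using ⟨1, map_one _⟩
  | insert a S ha ih =>
    rw [prod_insert ha, prod_insert ha]
    exact Submodule.mul_mem_mul (hv a (by simp)) (ih fun i hi => hv i (by simp [hi]))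

theorem prod_le_prod {R ι : Type*} [CommRing R] [Algebra ℂ R]
    {M N : ι → Submodule ℂ R} {S : Finset ι} (h : ∀ i ∈ S, M i ≤ N i) :
    ∏ i ∈ S, M i ≤ ∏ i ∈ S, N i :=
  prod_le_of_forall_prod_mem M S _ fun v hv => prod_mem_prod N S v fun i hi => h i hi (hv i hi)

theorem map_mem_prod {R ι : Type*} [CommRing R] [Algebra ℂ R] {M : ι → Submodule ℂ R}
    {S : Finset ι} (f : R →ₐ[ℂ] R) (h : ∀ i ∈ S, ∀ m ∈ M i, f m ∈ M i) {u : R}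
    (hu : u ∈ ∏ i ∈ S, M i) : f u ∈ ∏ i ∈ S, M i := by
  refine prod_le_of_forall_prod_mem M S ((∏ i ∈ S, M i).comap f.toLinearMap) (fun v hv => ?_) hu
  simp only [Submodule.mem_comap, AlgHom.toLinearMap_apply, map_prod]
  exact prod_mem_prod M S _ fun i hi => h i hi _ (hv i hi)

/-- `CoinvariantBound Q d`: for every action of a group `Γ` on a commutative algebra and stable
subspaces `M i` on which `Γ` acts through its quotient `Q`, every product of at least `d` vectors
taken from the `M i` lies in the ideal generated by the invariants in the nonempty partial
products of the `M i`. -/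
def CoinvariantBound (Q : Type) [Group Q] (d : ℕ) : Prop :=
  ∀ (Γ : Type) [Group Γ] (π : Γ →* Q), Function.Surjective π →
  ∀ (R : Type) [CommRing R] [Algebra ℂ R] (φ : Γ →* (R →ₐ[ℂ] R))
    (ι : Type) (M : ι → Submodule ℂ R) (E : Finset ι),
    (∀ i γ, ∀ m ∈ M i, φ γ m ∈ M i) → (∀ i γ, π γ = 1 → ∀ m ∈ M i, φ γ m = m) → d ≤ #E →
  ∀ (Z : Ideal R), (∀ S ⊆ E, S.Nonempty → ∀ u ∈ ∏ i ∈ S, M i, (∀ γ, φ γ u = u) → u ∈ Z) →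
  ∀ v : ι → R, (∀ i ∈ E, v i ∈ M i) → ∏ i ∈ E, v i ∈ Z

theorem CoinvariantBound.congr {Q Q' : Type} [Group Q] [Group Q'] {d : ℕ}
    (h : CoinvariantBound Q d) (e : Q ≃* Q') : CoinvariantBound Q' d := by
  intro Γ _ π hπ R _ _ φ ι M E hM hker
  refine h Γ (e.symm.toMonoidHom.comp π) (e.symm.surjective.comp hπ) R φ ι M E hM ?_
  intro i γ hγ
  exact hker i γ (by simpa using hγ)

theorem prod_monomial_single {R ι : Type} [CommRing R] (S : Finset ι) (v : ι → R) :
    ∏ i ∈ S, MvPolynomial.monomial (Finsupp.single i 1) (v i) =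
      MvPolynomial.monomial (∑ i ∈ S, Finsupp.single i 1) (∏ i ∈ S, v i) := by
  classical
  induction S using Finset.induction_on with
  | empty => simp
  | insert a S ha ih => rw [prod_insert ha, ih, MvPolynomial.monomial_mul, sum_insert ha,
      prod_insert ha]

section Rees

variable {R ι : Type} [CommRing R] [Algebra ℂ R] (M : ι → Submodule ℂ R)

/-- The multi-Rees algebra of a family of subspaces. -/
noncomputable def rees : Subalgebra ℂ (MvPolynomial ι R) where
  carrier := {f | ∀ m : ι →₀ ℕ, f.coeff m ∈ m.prod fun i k => M i ^ k}
  mul_mem' := by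
    classical
    intro f g hf hg m
    rw [MvPolynomial.coeff_mul]
    refine Submodule.sum_mem _ fun x hx => ?_
    rw [HasAntidiagonal.mem_antidiagonal] at hx
    rw [← hx, Finsupp.prod_add_index' (by simp) (fun i a b => pow_add _ _ _)]
    exact Submodule.mul_mem_mul (hf _) (hg _)
  add_mem' := by
    intro f g hf hg m
    rw [MvPolynomial.coeff_add]
    exact Submodule.add_mem _ (hf m) (hg m)
  algebraMap_mem' := by
    classical
    intro c m
    rw [IsScalarTower.algebraMap_apply ℂ R, MvPolynomial.algebraMap_eq, MvPolynomial.coeff_C]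
    split_ifs with h
    · subst h; simp
    · exact Submodule.zero_mem _

variable {M}

theorem map_mem_rees (f : R →ₐ[ℂ] R) (hf : ∀ i, ∀ m ∈ M i, f m ∈ M i) {g : MvPolynomial ι R}
    (hg : g ∈ rees M) : MvPolynomial.mapAlgHom f g ∈ rees M := by
  intro m
  rw [MvPolynomial.mapAlgHom_apply, MvPolynomial.coeff_map]
  have h1 := hg m
  have h2 : (m.prod fun i k => M i ^ k).map f.toLinearMap ≤ m.prod fun i k => M i ^ k := by
    simp only [Finsupp.prod]
    change Submodule.mapHom f _ ≤ _
    rw [map_prod]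
    refine prod_le_prod fun i _ => ?_
    rw [map_pow]
    refine pow_le_pow_left' ?_ _
    rintro _ ⟨x, hx, rfl⟩
    exact hf i x hx
  exact h2 ⟨_, h1, rfl⟩

/-- The induced action on the multi-Rees algebra. -/
noncomputable def reesAction {Γ : Type} [Group Γ] (φ : Γ →* (R →ₐ[ℂ] R))
    (hM : ∀ i γ, ∀ m ∈ M i, φ γ m ∈ M i) : Γ →* (rees M →ₐ[ℂ] rees M) where
  toFun γ := ((MvPolynomial.mapAlgHom (φ γ)).comp (rees M).val).codRestrict (rees M)
    fun x => map_mem_rees (φ γ) (fun i => hM i γ) x.2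
  map_one' := by
    refine AlgHom.ext fun x => Subtype.ext (MvPolynomial.ext _ _ fun m => ?_)
    change MvPolynomial.coeff m (MvPolynomial.map (φ 1 : R →+* R) x.1) = MvPolynomial.coeff m x.1
    rw [MvPolynomial.coeff_map, map_one]; rfl
  map_mul' a b := by
    refine AlgHom.ext fun x => Subtype.ext (MvPolynomial.ext _ _ fun m => ?_)
    change MvPolynomial.coeff m (MvPolynomial.map (φ (a * b) : R →+* R) x.1) =
      MvPolynomial.coeff m (MvPolynomial.map (φ a : R →+* R)
        (MvPolynomial.map (φ b : R →+* R) x.1))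
    rw [MvPolynomial.coeff_map, MvPolynomial.coeff_map, MvPolynomial.coeff_map, map_mul]; rfl

theorem coeff_reesAction {Γ : Type} [Group Γ] (φ : Γ →* (R →ₐ[ℂ] R))
    (hM : ∀ i γ, ∀ m ∈ M i, φ γ m ∈ M i) (γ : Γ) (f : rees M) (m : ι →₀ ℕ) :
    (reesAction φ hM γ f).1.coeff m = φ γ (f.1.coeff m) :=
  MvPolynomial.coeff_map _ _ _

variable (M) in
/-- The copy of `M i` in degree one of the multi-Rees algebra. -/
noncomputable def reesPart (i : ι) : Submodule ℂ (rees M) :=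
  ((M i).map ((MvPolynomial.monomial (Finsupp.single i 1)).restrictScalars ℂ)).comap
    (rees M).val.toLinearMap

theorem monomial_mem_rees (i : ι) {x : R} (hx : x ∈ M i) :
    MvPolynomial.monomial (Finsupp.single i 1) x ∈ rees M := by
  classical
  intro m
  rw [MvPolynomial.coeff_monomial]
  split_ifs with h
  · subst h; simpa using hx
  · exact Submodule.zero_mem _

theorem exists_of_mem_prod_reesPart {S : Finset ι} {f : rees M}
    (hf : f ∈ ∏ i ∈ S, reesPart M i) :
    ∃ x ∈ ∏ i ∈ S, M i, f.1 = MvPolynomial.monomial (∑ i ∈ S, Finsupp.single i 1) x := by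
  suffices h : ∏ i ∈ S, reesPart M i ≤ ((∏ i ∈ S, M i).map
      ((MvPolynomial.monomial (∑ i ∈ S, Finsupp.single i 1)).restrictScalars ℂ)).comap
      (rees M).val.toLinearMap by
    obtain ⟨x, hx, h⟩ := h hf
    exact ⟨x, hx, h.symm⟩
  refine prod_le_of_forall_prod_mem _ _ _ fun v hv => ?_
  choose! w hw using hv
  refine ⟨∏ i ∈ S, w i, prod_mem_prod _ _ _ fun i hi => (hw i hi).1, ?_⟩
  have : (∏ i ∈ S, v i).1 = ∏ i ∈ S, (v i).1 := map_prod (rees M).val _ _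
  exact ((prod_monomial_single S w).symm.trans
    (prod_congr rfl fun i hi => (hw i hi).2)).trans this.symm

theorem coeff_sum_single_mem {f : MvPolynomial ι R} (hf : f ∈ rees M) (S : Finset ι) :
    f.coeff (∑ i ∈ S, Finsupp.single i 1) ∈ ∏ i ∈ S, M i := by
  have h := hf (∑ i ∈ S, Finsupp.single i 1)
  rw [← Finsupp.prod_finsetSum_index (by simp) (fun i a b => pow_add _ _ _)] at h
  simpa using h

end Rees

open scoped Classical in
/-- The homogeneous form of `CoinvariantBound`, controlling the cofactors. -/
theorem CoinvariantBound.mem_of_forall_mul_mem {Q : Type} [Group Q] {d : ℕ}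
    (h : CoinvariantBound Q d) {Γ : Type} [Group Γ] (π : Γ →* Q) (hπ : Function.Surjective π)
    {R : Type} [CommRing R] [Algebra ℂ R] (φ : Γ →* (R →ₐ[ℂ] R))
    {ι : Type} (M : ι → Submodule ℂ R) (E : Finset ι)
    (hM : ∀ i γ, ∀ m ∈ M i, φ γ m ∈ M i) (hker : ∀ i γ, π γ = 1 → ∀ m ∈ M i, φ γ m = m)
    (hE : d ≤ #E) (Z : Submodule ℂ R)
    (hZ : ∀ S ⊆ E, S.Nonempty → ∀ u ∈ ∏ i ∈ S, M i, (∀ γ, φ γ u = u) →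
      ∀ w ∈ ∏ i ∈ E \ S, M i, u * w ∈ Z)
    (v : ι → R) (hv : ∀ i ∈ E, v i ∈ M i) : ∏ i ∈ E, v i ∈ Z := by
  set X : Set (rees M) := {f | ∃ S ⊆ E, S.Nonempty ∧ f ∈ ∏ i ∈ S, reesPart M i ∧
    ∀ γ, reesAction φ hM γ f = f} with hX
  set e : Finset ι → ι →₀ ℕ := fun S => ∑ i ∈ S, Finsupp.single i 1 with he
  have key : ∀ f ∈ Ideal.span X, ∀ r : rees M, (r * f).1.coeff (e E) ∈ Z := by
    intro f hf
    refine Submodule.span_induction (p := fun f _ => ∀ r : rees M, (r * f).1.coeff (e E) ∈ Z)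
      ?_ ?_ ?_ ?_ hf
    · rintro f ⟨S, hS, hSne, hf, hfix⟩ r
      obtain ⟨x, hx, hfx⟩ := exists_of_mem_prod_reesPart hf
      have hES : e E = e (E \ S) + e S := by
        simp only [he, sum_sdiff hS]
      have h1 : (r * f).1.coeff (e E) = r.1.coeff (e (E \ S)) * x := by
        change (r.1 * f.1).coeff (e E) = _
        rw [hfx, hES]
        exact MvPolynomial.coeff_mul_monomial _ _ _ _
      rw [h1, mul_comm]
      refine hZ S hS hSne x hx (fun γ => ?_) _ (coeff_sum_single_mem r.2 _)
      have h2 := coeff_reesAction φ hM γ f (e S)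
      rw [hfix γ, hfx] at h2
      simpa [he] using h2.symm
    · intro r
      simp
    · intro f g _ _ hf hg r
      rw [mul_add]
      exact Z.add_mem (hf r) (hg r)
    · intro a f _ hf r
      rw [smul_eq_mul, ← mul_assoc]
      exact hf _
  have hmem : ∏ i ∈ E, (if hi : i ∈ E then
      (⟨_, monomial_mem_rees i (hv i hi)⟩ : rees M) else 0) ∈ Ideal.span X := by
    refine h Γ π hπ (rees M) (reesAction φ hM) ι (reesPart M) E ?_ ?_ hE (Ideal.span X)
      (fun S hS hSne u hu hfix => Ideal.subset_span ⟨S, hS, hSne, hu, hfix⟩) _ ?_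
    · rintro i γ m ⟨x, hx, hm⟩
      refine ⟨φ γ x, hM i γ x hx, ?_⟩
      refine MvPolynomial.ext _ _ fun k => ?_
      refine Eq.trans ?_ (coeff_reesAction φ hM γ m k).symm
      rw [show m.1 = MvPolynomial.monomial (Finsupp.single i 1) x from hm.symm]
      simp only [LinearMap.coe_restrictScalars, MvPolynomial.coeff_monomial]
      split_ifs <;> simp
    · rintro i γ hγ m ⟨x, hx, hm⟩
      refine Subtype.ext (MvPolynomial.ext _ _ fun k => ?_)
      rw [coeff_reesAction, show m.1 = MvPolynomial.monomial (Finsupp.single i 1) x from hm.symm]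
      simp only [MvPolynomial.coeff_monomial]
      split_ifs
      · exact hker i γ hγ x hx
      · simp
    · intro i hi
      rw [dif_pos hi]
      exact ⟨v i, hv i hi, rfl⟩
  have h3 := key _ hmem 1
  rw [one_mul] at h3
  have h4 : (∏ i ∈ E, (if hi : i ∈ E then
      (⟨_, monomial_mem_rees i (hv i hi)⟩ : rees M) else 0)).1 =
      MvPolynomial.monomial (e E) (∏ i ∈ E, v i) := by
    rw [he, ← prod_monomial_single]
    refine (map_prod (rees M).val _ _).trans (prod_congr rfl fun i hi => ?_)
    rw [dif_pos hi]; rfl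
  rw [h4] at h3
  simpa using h3

theorem prod_le_ideal {R ι : Type} [CommRing R] [Algebra ℂ R]
    (M : ι → Submodule ℂ R) (S : Finset ι) (Z : Ideal R)
    (h : ∀ v : ι → R, (∀ i ∈ S, v i ∈ M i) → ∏ i ∈ S, v i ∈ Z) :
    ∀ w ∈ ∏ i ∈ S, M i, w ∈ Z :=
  prod_le_of_forall_prod_mem M S (Z.restrictScalars ℂ) h

open scoped Classical in
/-- Under `CoinvariantBound Q d`, invariant blocks of at most `d` factors can be split off. -/
theorem CoinvariantBound.mem_of_forall_block {Q : Type} [Group Q] {d : ℕ}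
    (h : CoinvariantBound Q d) {Γ : Type} [Group Γ] (π : Γ →* Q) (hπ : Function.Surjective π)
    {R : Type} [CommRing R] [Algebra ℂ R] (φ : Γ →* (R →ₐ[ℂ] R))
    {ι : Type} (M : ι → Submodule ℂ R) (U : Finset ι)
    (hM : ∀ i γ, ∀ m ∈ M i, φ γ m ∈ M i) (hker : ∀ i γ, π γ = 1 → ∀ m ∈ M i, φ γ m = m)
    (hU : d ≤ #U) (Z : Ideal R)
    (hZ : ∀ S ⊆ U, S.Nonempty → #S ≤ d → ∀ u ∈ ∏ i ∈ S, M i, (∀ γ, φ γ u = u) →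
      ∀ w ∈ ∏ i ∈ U \ S, M i, u * w ∈ Z) :
    ∀ w ∈ ∏ i ∈ U, M i, w ∈ Z := by
  obtain ⟨U₀, hU₀, hc⟩ := exists_subset_card_eq hU
  refine prod_le_ideal M U Z fun v hv => ?_
  rw [← prod_sdiff hU₀, mul_comm]
  refine h.mem_of_forall_mul_mem π hπ φ M U₀ hM hker hc.ge
    ((Z.restrictScalars ℂ).comap (LinearMap.mulRight ℂ (∏ i ∈ U \ U₀, v i))) ?_ v
    (fun i hi => hv i (hU₀ hi))
  intro S hS hSne u hu hfix w hw
  change u * w * _ ∈ Z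
  rw [mul_assoc]
  refine hZ S (hS.trans hU₀) hSne ((card_le_card hS).trans hc.le) u hu hfix _ ?_
  have : U \ S = (U₀ \ S) ∪ (U \ U₀) := by
    ext i
    simp only [mem_sdiff, mem_union]
    have := @hS i
    have := @hU₀ i
    tauto
  rw [this, prod_union]
  · exact Submodule.mul_mem_mul hw (prod_mem_prod _ _ _ fun i hi => hv i (mem_sdiff.1 hi).1)
  · refine disjoint_left.2 fun i hi hi' => ?_
    rw [mem_sdiff] at hi hi'
    exact hi'.2 hi.1

open scoped Classical in
/-- Splitting off disjoint good blocks one after another. -/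
theorem mem_of_forall_blocks {R ι : Type} [CommRing R] [Algebra ℂ R] (M : ι → Submodule ℂ R)
    (F : Submodule ℂ R) (good : Finset ι → Prop) (L : ℕ → ℕ) (b : ℕ) (E : Finset ι)
    (hE : L b ≤ #E) (Z : Ideal R)
    (step : ∀ j < b, ∀ U ⊆ E, L (j + 1) ≤ #U → ∀ Z' : Ideal R, Z ≤ Z' →
      (∀ S ⊆ U, S.Nonempty → good S → L j ≤ #(U \ S) → ∀ u ∈ ∏ i ∈ S, M i, u ∈ F →
        ∀ w ∈ ∏ i ∈ U \ S, M i, u * w ∈ Z') → ∀ w ∈ ∏ i ∈ U, M i, w ∈ Z')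
    (final : ∀ (S : ℕ → Finset ι) (u : ℕ → R), (∀ j < b, S j ⊆ E ∧ (S j).Nonempty ∧ good (S j) ∧
      u j ∈ ∏ i ∈ S j, M i ∧ u j ∈ F) → (∀ j < b, ∀ k < j, Disjoint (S j) (S k)) →
      ∀ w ∈ ∏ i ∈ E \ (range b).biUnion S, M i, (∏ j ∈ range b, u j) * w ∈ Z) :
    ∀ w ∈ ∏ i ∈ E, M i, w ∈ Z := by
  suffices H : ∀ j k, j + k = b → ∀ (S : ℕ → Finset ι) (u : ℕ → R),
      (∀ l < k, S l ⊆ E ∧ (S l).Nonempty ∧ good (S l) ∧ u l ∈ ∏ i ∈ S l, M i ∧ u l ∈ F) →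
      (∀ l < k, ∀ m < l, Disjoint (S l) (S m)) → L j ≤ #(E \ (range k).biUnion S) →
      ∀ w ∈ ∏ i ∈ E \ (range k).biUnion S, M i, (∏ l ∈ range k, u l) * w ∈ Z by
    simpa using H b 0 (by simp) (fun _ => ∅) (fun _ => 0) (by simp) (by simp) (by simpa using hE)
  intro j
  induction j with
  | zero =>
    intro k hk S u hS hdis _
    obtain rfl : k = b := by omega
    exact final S u hS hdis
  | succ j ih =>
    intro k hk S u hS hdis hL
    set U := E \ (range k).biUnion S with hU
    refine step j (by omega) U sdiff_subset hL
      (Submodule.comap (LinearMap.mulLeft R (∏ l ∈ range k, u l)) Z)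
      (fun z hz => Z.mul_mem_left _ hz) ?_
    intro T hT hTne hTgood hTL t ht htF w hw
    change (∏ l ∈ range k, u l) * (t * w) ∈ Z
    have hlt : ∀ l, l < k → l ≠ k := fun l h => h.ne
    have hU' : (range (k + 1)).biUnion (fun l => if l = k then T else S l) =
        T ∪ (range k).biUnion S := by
      rw [range_add_one, biUnion_insert, if_pos rfl]
      congr 1
      refine biUnion_congr rfl fun l hl => ?_
      rw [if_neg (hlt l (by simpa using hl))]
    have hU'' : E \ (range (k + 1)).biUnion (fun l => if l = k then T else S l) = U \ T := by
      rw [hU', hU, sdiff_sdiff_left, union_comm]; rfl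
    have := ih (k + 1) (by omega) (fun l => if l = k then T else S l)
      (fun l => if l = k then t else u l) ?_ ?_ (by rw [hU'']; exact hTL) w (by rwa [hU''])
    · rw [prod_range_succ, if_pos rfl, prod_congr rfl (g := u)] at this
      · rwa [mul_assoc] at this
      · intro l hl
        rw [if_neg (hlt l (by simpa using hl))]
    · intro l hl
      by_cases hlk : l = k
      · simp only [hlk, if_true]
        exact ⟨hT.trans sdiff_subset, hTne, hTgood, ht, htF⟩
      · simp only [hlk, if_false]
        exact hS l (by omega)
    · intro l hl m hm
      have hmk : m ≠ k := by omega
      by_cases hlk : l = k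
      · simp only [hlk, if_true, hmk, if_false]
        refine disjoint_left.2 fun i hi hi' => (mem_sdiff.1 (hT hi)).2 ?_
        exact mem_biUnion.2 ⟨m, mem_range.2 (by omega), hi'⟩
      · simp only [hlk, if_false, hmk]
        exact hdis l (by omega) m hm

section Act

variable {Γ B R : Type} [Group Γ] [Group B] [CommRing R] [Algebra ℂ R]

/-- The action of the quotient `B` of `Γ`, through a set-theoretic section. -/
noncomputable def act (π : Γ →* B) (hπ : Function.Surjective π) (φ : Γ →* (R →ₐ[ℂ] R)) (b : B) :
    R →ₐ[ℂ] R := φ (Function.surjInv hπ b)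

variable {π : Γ →* B} (hπ : Function.Surjective π) (φ : Γ →* (R →ₐ[ℂ] R))

theorem apply_eq_of_map_eq {z : R} (hz : ∀ γ, π γ = 1 → φ γ z = z) {γ δ : Γ} (h : π γ = π δ) :
    φ γ z = φ δ z := by
  have : φ (δ⁻¹ * γ) z = z := hz _ (by simp [h])
  conv_rhs => rw [← this]
  rw [← AlgHom.mul_apply, ← map_mul]
  simp

theorem apply_eq_act {z : R} (hz : ∀ γ, π γ = 1 → φ γ z = z) (γ : Γ) :
    φ γ z = act π hπ φ (π γ) z :=
  apply_eq_of_map_eq φ hz (Function.surjInv_eq hπ _).symm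

theorem act_one {z : R} (hz : ∀ γ, π γ = 1 → φ γ z = z) : act π hπ φ 1 z = z := by
  rw [← map_one π, ← apply_eq_act hπ φ hz, map_one]; rfl

theorem apply_ker_fixed {z : R} (hz : ∀ γ, π γ = 1 → φ γ z = z) (δ : Γ) :
    ∀ γ, π γ = 1 → φ γ (φ δ z) = φ δ z := by
  intro γ hγ
  rw [← AlgHom.mul_apply, ← map_mul]
  exact apply_eq_of_map_eq φ hz (by simp [hγ])

theorem act_mul {z : R} (hz : ∀ γ, π γ = 1 → φ γ z = z) (a b : B) :
    act π hπ φ (a * b) z = act π hπ φ a (act π hπ φ b z) := by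
  simp only [act]
  rw [← AlgHom.mul_apply, ← map_mul]
  refine apply_eq_of_map_eq φ hz ?_
  simp [Function.surjInv_eq]

theorem apply_sum_act [Fintype B] {z : R} (hz : ∀ γ, π γ = 1 → φ γ z = z) (γ : Γ) :
    φ γ (∑ h, act π hπ φ h z) = ∑ h, act π hπ φ h z := by
  rw [map_sum, ← Equiv.sum_comp (Equiv.mulLeft (π γ)) (fun h => act π hπ φ h z)]
  refine sum_congr rfl fun h _ => ?_
  rw [Equiv.coe_mulLeft, act_mul hπ φ hz]
  exact apply_eq_act hπ φ (apply_ker_fixed φ hz _) γ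

open scoped Classical in
theorem sum_translate_mem [Fintype B] {κ : Type} (N : κ → Submodule ℂ R)
    (hN : ∀ j γ, ∀ m ∈ N j, φ γ m ∈ N j) (J : Finset κ) (z : κ → R) (hz : ∀ j ∈ J, z j ∈ N j)
    (hker : ∀ j ∈ J, ∀ γ, π γ = 1 → φ γ (z j) = z j) (Z : Ideal R) (T : Finset κ) (hT : T ⊆ J)
    (hZ : ∀ u ∈ ∏ j ∈ T, N j, (∀ γ, φ γ u = u) → u ∈ Z) (x : κ → B) :
    ∑ h, ∏ j ∈ J, act π hπ φ (if j ∈ T then h * x j else x j) (z j) ∈ Z := by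
  have h1 : ∀ h : B, ∏ j ∈ J, act π hπ φ (if j ∈ T then h * x j else x j) (z j) =
      (∏ j ∈ J \ T, act π hπ φ (x j) (z j)) *
        act π hπ φ h (∏ j ∈ T, act π hπ φ (x j) (z j)) := by
    intro h
    rw [← prod_sdiff hT, map_prod]
    congr 1
    · refine prod_congr rfl fun j hj => ?_
      rw [if_neg (mem_sdiff.1 hj).2]
    · refine prod_congr rfl fun j hj => ?_
      rw [if_pos hj, act_mul hπ φ (hker j (hT hj))]
  rw [sum_congr rfl fun h _ => h1 h, ← mul_sum]
  have hfix : ∀ γ, π γ = 1 → φ γ (∏ j ∈ T, act π hπ φ (x j) (z j)) =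
      ∏ j ∈ T, act π hπ φ (x j) (z j) := by
    intro γ hγ
    rw [map_prod]
    exact prod_congr rfl fun j hj => apply_ker_fixed φ (hker j (hT hj)) _ γ hγ
  refine Z.mul_mem_left _ (hZ _ ?_ fun γ => apply_sum_act hπ φ hfix γ)
  refine Submodule.sum_mem _ fun h _ => map_mem_prod _ (fun j _ => hN j _) ?_
  exact prod_mem_prod _ _ _ fun j hj => hN j _ _ (hz j (hT hj))

end Act

theorem coinvariantBound_card (Q : Type) [Group Q] [Finite Q] :
    CoinvariantBound Q (Nat.card Q) := by
  classical
  have := Fintype.ofFinite Q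
  intro Γ _ π hπ R _ _ φ ι M E hM hker hE Z hZ v hv
  rw [Nat.card_eq_fintype_card] at hE
  obtain ⟨E₀, hE₀, hc⟩ := exists_subset_card_eq hE
  rw [← prod_sdiff hE₀]
  refine Z.mul_mem_left _ ?_
  let e : Q ≃ E₀ := Fintype.equivOfCardEq (by rw [Fintype.card_coe, hc])
  have hmem : ∀ j, v (e j) ∈ M (e j) := fun j => hv _ (hE₀ (e j).2)
  have hkf : ∀ j γ, π γ = 1 → φ γ (v (e j)) = v (e j) := fun j γ hγ => hker _ γ hγ _ (hmem j)
  have h0 := eq_zero_of_translate_sums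
    (fun y : Q → Q => Ideal.Quotient.mkₐ ℂ Z (∏ j, act π hπ φ (y j) (v (e j)))) ?_
  · rw [Ideal.Quotient.mkₐ_eq_mk, Ideal.Quotient.eq_zero_iff_mem] at h0
    rw [← prod_coe_sort, ← e.prod_comp]
    convert h0 using 2 with j
    exact (act_one hπ φ (hkf j)).symm
  · intro y T hT
    rw [← map_sum, Ideal.Quotient.mkₐ_eq_mk, Ideal.Quotient.eq_zero_iff_mem]
    refine sum_translate_mem hπ φ (fun j => M (e j)) (fun j => hM _) univ _ (fun j _ => hmem j)
      (fun j _ => hkf j) Z T (subset_univ _) ?_ y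
    intro u hu hfix
    refine hZ (T.map (e.toEmbedding.trans (Function.Embedding.subtype _))) ?_ (by simpa using hT)
      u (by rwa [prod_map]) hfix
    intro i hi
    obtain ⟨j, _, rfl⟩ := mem_map.1 hi
    exact hE₀ (e j).2

/-- The subspace of vectors fixed by a subgroup. -/
def fixedBy {Γ R : Type} [Group Γ] [CommRing R] [Algebra ℂ R] (φ : Γ →* (R →ₐ[ℂ] R))
    (Δ : Subgroup Γ) : Submodule ℂ R where
  carrier := {r | ∀ γ ∈ Δ, φ γ r = r}
  add_mem' := by
    intro a b ha hb γ hγ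
    rw [map_add, ha γ hγ, hb γ hγ]
  zero_mem' := fun γ _ => map_zero _
  smul_mem' := by
    intro c a ha γ hγ
    rw [map_smul, ha γ hγ]

theorem map_mem_fixedBy {Γ R : Type} [Group Γ] [CommRing R] [Algebra ℂ R] (φ : Γ →* (R →ₐ[ℂ] R))
    (Δ : Subgroup Γ) [hΔ : Δ.Normal] {r : R} (hr : r ∈ fixedBy φ Δ) (γ : Γ) :
    φ γ r ∈ fixedBy φ Δ := by
  intro δ hδ
  have h := hr (γ⁻¹ * δ * γ) (by simpa using hΔ.conj_mem δ hδ γ⁻¹)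
  conv_rhs => rw [← h]
  rw [← AlgHom.mul_apply, ← AlgHom.mul_apply, ← map_mul, ← map_mul]
  congr 2
  group

theorem CoinvariantBound.mul {G Q : Type} [Group G] [Group Q] (g : G →* Q)
    (hg : Function.Surjective g) {a b : ℕ} (ha : CoinvariantBound g.ker a)
    (hb : CoinvariantBound Q b) : CoinvariantBound G (a * b) := by
  classical
  intro Γ _ π hπ R _ _ φ ι M E hM hker hE Z hZ v hv
  set Δ := (g.comp π).ker with hΔ
  have hΔ' : Δ = g.ker.comap π := rfl
  refine mem_of_forall_blocks M (fixedBy φ Δ) (fun _ => True) (fun j => a * j) b E hE Z ?_ ?_ _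
    (prod_mem_prod M E v hv)
  · intro j _ U hU hUc Z' _ hZ'
    refine ha.mem_of_forall_block (π.subgroupComap g.ker)
      (π.subgroupComap_surjective_of_surjective g.ker hπ) (φ.comp Δ.subtype) M U
      (fun i γ => hM i γ) (fun i γ hγ => hker i γ (congrArg Subtype.val hγ))
      (le_trans (by rw [mul_add]; omega) hUc) Z' ?_
    intro S hS hSne hSc u hu hfix w hw
    refine hZ' S hS hSne trivial ?_ u hu (fun γ hγ => hfix ⟨γ, hγ⟩) w hw
    rw [card_sdiff_of_subset hS]
    rw [mul_add, mul_one] at hUc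
    omega
  · intro S u hS hdis w hw
    refine Z.mul_mem_right _ ?_
    refine hb Γ (g.comp π) (hg.comp hπ) R φ ℕ (fun j => (∏ i ∈ S j, M i) ⊓ fixedBy φ Δ) (range b)
      ?_ ?_ (by simp) Z ?_ u ?_
    · intro j γ m hm
      exact ⟨map_mem_prod _ (fun i _ => hM i γ) hm.1, map_mem_fixedBy φ Δ hm.2 γ⟩
    · intro j γ hγ m hm
      exact hm.2 γ hγ
    · intro T hT hTne u hu hfix
      refine hZ (T.biUnion S) ?_ ?_ u ?_ hfix
      · exact biUnion_subset.2 fun j hj => (hS j (mem_range.1 (hT hj))).1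
      · obtain ⟨j, hj⟩ := hTne
        exact biUnion_nonempty.2 ⟨j, hj, (hS j (mem_range.1 (hT hj))).2.1⟩
      · rw [prod_biUnion]
        · exact prod_le_prod (fun i _ => inf_le_left) hu
        · intro i hi j hj hij
          have hi' := mem_range.1 (hT hi)
          have hj' := mem_range.1 (hT hj)
          rcases lt_or_gt_of_ne hij with h | h
          · exact (hdis j hj' i h).symm
          · exact hdis i hi' j h
    · intro j hj
      exact (hS j (mem_range.1 hj)).2.2.2

section Weights

variable {Γ V R : Type} [Group Γ] [AddCommGroup V] [CommRing R] [Algebra ℂ R]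

/-- The weight space of a character. -/
def weightSpace (π : Γ →* Multiplicative V) (φ : Γ →* (R →ₐ[ℂ] R)) (χ : AddChar V ℂ) :
    Submodule ℂ R where
  carrier := {r | ∀ γ, φ γ r = χ (π γ).toAdd • r}
  add_mem' := by
    intro a b ha hb γ
    rw [map_add, ha γ, hb γ, smul_add]
  zero_mem' := fun γ => by simp
  smul_mem' := by
    intro c a ha γ
    rw [map_smul, ha γ, smul_comm]

variable {π : Γ →* Multiplicative V} {φ : Γ →* (R →ₐ[ℂ] R)}

theorem prod_weightSpace_le {ι : Type} (S : Finset ι) (χ : ι → AddChar V ℂ) :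
    ∏ i ∈ S, weightSpace π φ (χ i) ≤ weightSpace π φ (∑ i ∈ S, χ i) := by
  refine prod_le_of_forall_prod_mem _ _ _ fun v hv γ => ?_
  rw [map_prod, AddChar.sum_apply, prod_congr rfl fun i hi => hv i hi γ, prod_smul]

theorem apply_eq_of_sum_eq_zero {ι : Type} {S : Finset ι} {χ : ι → AddChar V ℂ}
    (hS : ∑ i ∈ S, χ i = 0) {u : R} (hu : u ∈ ∏ i ∈ S, weightSpace π φ (χ i)) (γ : Γ) :
    φ γ u = u := by
  have h := prod_weightSpace_le S χ hu γ
  rw [hS] at h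
  simpa using h

theorem le_span_weightSpace [Finite V] (hπ : Function.Surjective π) (M : Submodule ℂ R)
    (hM : ∀ γ, ∀ m ∈ M, φ γ m ∈ M) (hker : ∀ γ, π γ = 1 → ∀ m ∈ M, φ γ m = m) :
    M ≤ Submodule.span ℂ {r | ∃ χ, r ∈ M ⊓ weightSpace π φ χ} := by
  classical
  have := Fintype.ofFinite V
  intro m hm
  set a : V → R := fun b => act π hπ φ (Multiplicative.ofAdd b) m with ha
  set f : AddChar V ℂ → R := fun χ => ∑ b, χ (-b) • a b with hf
  have hkm : ∀ γ, π γ = 1 → φ γ m = m := fun γ hγ => hker γ hγ m hm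
  have hfM : ∀ χ, f χ ∈ M ⊓ weightSpace π φ χ := by
    intro χ
    refine ⟨Submodule.sum_mem _ fun b _ => M.smul_mem _ (hM _ _ hm), fun γ => ?_⟩
    simp only [hf, map_sum, map_smul, smul_sum]
    rw [← Equiv.sum_comp (Equiv.addLeft (π γ).toAdd)
      (fun b => χ (π γ).toAdd • χ (-b) • a b)]
    refine sum_congr rfl fun b _ => ?_
    rw [smul_smul, ← AddChar.map_add_eq_mul, Equiv.coe_addLeft, neg_add,
      add_neg_cancel_left]
    congr 1
    simp only [ha]
    rw [ofAdd_add, act_mul hπ φ hkm, ofAdd_toAdd]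
    exact apply_eq_act hπ φ (apply_ker_fixed φ hkm _) γ
  have hsum : ∑ χ, f χ = (Fintype.card V : ℂ) • m := by
    simp only [hf]
    rw [sum_comm]
    simp only [← sum_smul, AddChar.sum_apply_eq_ite, neg_eq_zero, ite_smul, zero_smul]
    rw [sum_ite_eq' univ 0 (fun b => (Fintype.card V : ℂ) • a b), if_pos (mem_univ _)]
    simp only [ha, ofAdd_zero, act_one hπ φ hkm]
  have hc : (Fintype.card V : ℂ) ≠ 0 := by simp
  rw [← inv_smul_smul₀ hc m, ← hsum]
  exact Submodule.smul_mem _ _ (Submodule.sum_mem _ fun χ _ =>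
    Submodule.subset_span ⟨χ, hfM χ⟩)

end Weights

theorem prod_le_of_le_span {R ι : Type} [CommRing R] [Algebra ℂ R]
    (M : ι → Submodule ℂ R) (C : ι → Set R) (S : Finset ι) : ∀ N : Submodule ℂ R,
    (∀ i ∈ S, M i ≤ Submodule.span ℂ (C i)) →
    (∀ v : ι → R, (∀ i ∈ S, v i ∈ C i) → ∏ i ∈ S, v i ∈ N) → ∏ i ∈ S, M i ≤ N := by
  classical
  induction S using Finset.induction_on with
  | empty =>
    intro N _ h
    rw [prod_empty, Submodule.one_le]
    simpa using h 0 (by simp)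
  | insert a S ha ih =>
    intro N hC h
    rw [prod_insert ha, Submodule.mul_le]
    intro x hx y hy
    suffices H : Submodule.span ℂ (C a) ≤ N.comap (LinearMap.mulRight ℂ y) from
      H (hC a (mem_insert_self _ _) hx)
    rw [Submodule.span_le]
    intro x hx
    refine ih (N.comap (LinearMap.mulLeft ℂ x)) (fun i hi => hC i (mem_insert_of_mem hi))
      (fun v hv => ?_) hy
    have := h (fun i => if i = a then x else v i) (by
      intro i hi
      by_cases hia : i = a
      · subst hia; simpa using hx
      · simpa [hia] using hv i (by simpa [hia] using hi))
    rw [prod_insert ha] at this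
    have h2 : ∏ i ∈ S, (if i = a then x else v i) = ∏ i ∈ S, v i := by
      refine prod_congr rfl fun i hi => ?_
      rw [if_neg]
      rintro rfl
      exact ha hi
    simpa [h2] using this

/-- Membership in an ideal of all products may be checked on weight vectors. -/
theorem prod_mem_of_forall_weightSpace {Γ V R ι : Type} [Group Γ] [AddCommGroup V] [Finite V]
    [CommRing R] [Algebra ℂ R] {π : Γ →* Multiplicative V} (hπ : Function.Surjective π)
    {φ : Γ →* (R →ₐ[ℂ] R)} (M : ι → Submodule ℂ R) (U : Finset ι)
    (hM : ∀ i γ, ∀ m ∈ M i, φ γ m ∈ M i) (hker : ∀ i γ, π γ = 1 → ∀ m ∈ M i, φ γ m = m)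
    (Z : Ideal R)
    (h : ∀ χ : ι → AddChar V ℂ, ∀ w ∈ ∏ i ∈ U, (M i ⊓ weightSpace π φ (χ i)), w ∈ Z) :
    ∀ w ∈ ∏ i ∈ U, M i, w ∈ Z := by
  refine prod_le_of_le_span M (fun i => {r | ∃ χ, r ∈ M i ⊓ weightSpace π φ χ}) U
    (Z.restrictScalars ℂ) (fun i _ => le_span_weightSpace hπ (M i) (hM i) (hker i)) ?_
  intro v hv
  choose! χ hχ using hv
  exact h χ _ (prod_mem_prod _ _ _ hχ)

theorem coinvariantBound_of_zero_sum {V : Type} [AddCommGroup V] [Finite V] {d : ℕ}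
    (hV : ∀ (ι : Type) (χ : ι → AddChar V ℂ) (U : Finset ι), d ≤ #U →
      ∃ S ⊆ U, S.Nonempty ∧ ∑ i ∈ S, χ i = 0) : CoinvariantBound (Multiplicative V) d := by
  classical
  intro Γ _ π hπ R _ _ φ ι M E hM hker hE Z hZ v hv
  refine prod_mem_of_forall_weightSpace hπ M E hM hker Z (fun χ w hw => ?_) _
    (prod_mem_prod M E v hv)
  refine prod_le_ideal _ _ Z (fun v hv => ?_) w hw
  obtain ⟨S, hS, hSne, h0⟩ := hV ι χ E hE
  rw [← prod_sdiff hS]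
  refine Z.mul_mem_left _ (hZ S hS hSne _ (prod_mem_prod _ _ _ fun i hi => (hv i (hS hi)).1) ?_)
  exact apply_eq_of_sum_eq_zero h0 (prod_mem_prod _ _ _ fun i hi => (hv i (hS hi)).2)

theorem exists_zero_sum_of_finrank_lt {p : ℕ} [Fact p.Prime] {W ι : Type} [AddCommGroup W]
    [Module (ZMod p) W] [FiniteDimensional (ZMod p) W] (c : ι → W) (U : Finset ι)
    (hU : Module.finrank (ZMod p) W * (p - 1) < #U) :
    ∃ S ⊆ U, S.Nonempty ∧ ∑ i ∈ S, c i = 0 := by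
  classical
  set b := Module.finBasis (ZMod p) W
  set f : Fin (Module.finrank (ZMod p) W) → MvPolynomial U (ZMod p) := fun j =>
    ∑ i : U, MvPolynomial.C (b.repr (c i) j) * MvPolynomial.X i ^ (p - 1) with hf
  have hdeg : ∀ j, (f j).totalDegree ≤ p - 1 := by
    intro j
    refine (MvPolynomial.totalDegree_finsetSum _ _).trans (Finset.sup_le fun i _ => ?_)
    refine (MvPolynomial.totalDegree_mul _ _).trans ?_
    rw [MvPolynomial.totalDegree_C, zero_add, MvPolynomial.totalDegree_X_pow]
  have hsum : ∑ j, (f j).totalDegree < Fintype.card U := by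
    rw [Fintype.card_coe]
    refine lt_of_le_of_lt (sum_le_sum fun j _ => hdeg j) ?_
    simpa using hU
  have hp1 : p - 1 ≠ 0 := by have := (Fact.out : p.Prime).two_le; omega
  have hdvd := char_dvd_card_solutions_of_fintype_sum_lt p hsum
  have h0 : ∀ j, MvPolynomial.eval (0 : U → ZMod p) (f j) = 0 := by
    intro j
    simp [hf, hp1]
  have hpos : 1 < Fintype.card {x : U → ZMod p // ∀ j, MvPolynomial.eval x (f j) = 0} := by
    refine lt_of_lt_of_le (Fact.out : p.Prime).one_lt (Nat.le_of_dvd ?_ (by convert hdvd))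
    exact Fintype.card_pos_iff.2 ⟨⟨0, h0⟩⟩
  obtain ⟨⟨x, hx⟩, hne⟩ := Fintype.exists_ne_of_one_lt_card hpos ⟨0, h0⟩
  have hx0 : x ≠ 0 := fun h => hne (Subtype.ext h)
  refine ⟨(univ.filter fun i : U => x i ≠ 0).map (Function.Embedding.subtype _), ?_, ?_, ?_⟩
  · intro i hi
    obtain ⟨j, _, rfl⟩ := mem_map.1 hi
    exact j.2
  · obtain ⟨i, hi⟩ := Function.ne_iff.1 hx0
    exact ⟨i, mem_map.2 ⟨i, by simpa using hi, rfl⟩⟩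
  · rw [sum_map]
    refine b.repr.injective (Finsupp.ext fun j => ?_)
    have := hx j
    simp only [hf, map_sum, map_mul, map_pow, MvPolynomial.eval_C, MvPolynomial.eval_X] at this
    rw [map_sum, map_zero, Finsupp.coe_zero, Pi.zero_apply, Finsupp.finsetSum_apply, sum_filter]
    refine Eq.trans ?_ this
    refine sum_congr rfl fun i _ => ?_
    split_ifs with hi
    · rw [ZMod.pow_card_sub_one_eq_one hi, mul_one]; rfl
    · rw [not_not] at hi
      rw [hi, zero_pow hp1, mul_zero]

theorem coinvariantBound_elementary {V : Type} [AddCommGroup V] [Finite V] {p k : ℕ}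
    [Fact p.Prime] (hV : ∀ x : V, p • x = 0) (hcard : Nat.card V = p ^ k) :
    CoinvariantBound (Multiplicative V) (k * (p - 1) + 1) := by
  refine coinvariantBound_of_zero_sum fun ι χ U hU => ?_
  have := Fintype.ofFinite V
  have htor : ∀ χ : AddChar V ℂ, p • χ = 0 := by
    intro χ
    ext x
    rw [AddChar.nsmul_apply, ← AddChar.map_nsmul_eq_pow, hV x, AddChar.map_zero_eq_one,
      AddChar.zero_apply]
  let inst : Module (ZMod p) (AddChar V ℂ) := AddCommGroup.zmodModule htor
  have hfin : FiniteDimensional (ZMod p) (AddChar V ℂ) :=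
    Module.Finite.of_finite
  have hfr : Module.finrank (ZMod p) (AddChar V ℂ) = k := by
    have h1 := Module.card_eq_pow_finrank (K := ZMod p) (V := AddChar V ℂ)
    rw [AddChar.card_eq, ← Nat.card_eq_fintype_card, hcard, ZMod.card] at h1
    exact (Nat.pow_right_injective (Fact.out : p.Prime).two_le h1).symm
  exact @exists_zero_sum_of_finrank_lt p _ (AddChar V ℂ) ι _ inst hfin χ U (by rw [hfr]; omega)

open scoped Classical in
/-- In degree `K`, up to products of invariants, every product splits off a `P`-invariant block
of at most `h` factors. -/
def ShortBlocks {G : Type} [Group G] (P : Subgroup G) (h K : ℕ) : Prop :=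
  ∀ (Γ : Type) [Group Γ] (π : Γ →* G), Function.Surjective π →
  ∀ (R : Type) [CommRing R] [Algebra ℂ R] (φ : Γ →* (R →ₐ[ℂ] R)) (ι : Type)
    (M : ι → Submodule ℂ R) (U : Finset ι), (∀ i γ, ∀ m ∈ M i, φ γ m ∈ M i) →
    (∀ i γ, π γ = 1 → ∀ m ∈ M i, φ γ m = m) → K ≤ #U → ∀ Z : Ideal R,
    (∀ S ⊆ U, S.Nonempty → ∀ u ∈ ∏ i ∈ S, M i, (∀ γ, φ γ u = u) → u ∈ Z) →
    (∀ S ⊆ U, S.Nonempty → #S ≤ h → ∀ u ∈ ∏ i ∈ S, M i, u ∈ fixedBy φ (P.comap π) →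
      ∀ w ∈ ∏ i ∈ U \ S, M i, u * w ∈ Z) → ∀ w ∈ ∏ i ∈ U, M i, w ∈ Z

theorem coinvariantBound_of_shortBlocks {G : Type} [Group G] (P : Subgroup G) [P.Normal]
    {p h a b : ℕ} (hP : CoinvariantBound P p) (hQ : CoinvariantBound (G ⧸ P) b) (hab : a ≤ b)
    (hS : ShortBlocks P h (p * a + h)) : CoinvariantBound G (p * a + h * (b - a)) := by
  classical
  intro Γ _ π hπ R _ _ φ ι M E hM hker hE Z hZ v hv
  set g := QuotientGroup.mk' P with hg
  set Δ := P.comap π with hΔ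
  have hΔ' : ∀ γ, g.comp π γ = 1 ↔ γ ∈ Δ := fun γ => QuotientGroup.eq_one_iff (π γ)
  refine mem_of_forall_blocks M (fixedBy φ Δ) (fun _ => True)
    (fun j => p * min j a + h * (j - a)) b E (by simpa [min_eq_right hab] using hE) Z ?_ ?_ _
    (prod_mem_prod M E v hv)
  · intro j _ U hU hUc Z' hZZ' hZ'
    by_cases hja : j < a
    · rw [min_eq_left (by omega), show j + 1 - a = 0 by omega] at hUc
      refine hP.mem_of_forall_block (π.subgroupComap P)
        (π.subgroupComap_surjective_of_surjective P hπ) (φ.comp Δ.subtype) M U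
        (fun i γ => hM i γ) (fun i γ hγ => hker i γ (congrArg Subtype.val hγ))
        (le_trans (by rw [mul_add]; omega) hUc) Z' ?_
      intro S hS hSne hSc u hu hfix w hw
      refine hZ' S hS hSne trivial ?_ u hu (fun γ hγ => hfix ⟨γ, hγ⟩) w hw
      rw [card_sdiff_of_subset hS, min_eq_left hja.le, show j - a = 0 by omega]
      rw [mul_add, mul_one] at hUc
      omega
    · rw [min_eq_right (by omega), show j + 1 - a = j - a + 1 by omega, mul_add, mul_one] at hUc
      refine hS Γ π hπ R φ ι M U hM hker (by omega) Z' ?_ ?_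
      · intro S hS hSne u hu hfix
        exact hZZ' (hZ S (hS.trans hU) hSne u hu hfix)
      · intro S hS hSne hSc u hu hfix w hw
        refine hZ' S hS hSne trivial ?_ u hu hfix w hw
        rw [card_sdiff_of_subset hS, min_eq_right (by omega)]
        omega
  · intro S u hS hdis w hw
    refine Z.mul_mem_right _ ?_
    refine hQ Γ (g.comp π) ((QuotientGroup.mk'_surjective P).comp hπ) R φ ℕ
      (fun j => (∏ i ∈ S j, M i) ⊓ fixedBy φ Δ) (range b) ?_ ?_ (by simp) Z ?_ u ?_
    · intro j γ m hm
      exact ⟨map_mem_prod _ (fun i _ => hM i γ) hm.1, map_mem_fixedBy φ Δ hm.2 γ⟩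
    · intro j γ hγ m hm
      exact hm.2 γ ((hΔ' γ).1 hγ)
    · intro T hT hTne u hu hfix
      refine hZ (T.biUnion S) ?_ ?_ u ?_ hfix
      · exact biUnion_subset.2 fun j hj => (hS j (mem_range.1 (hT hj))).1
      · obtain ⟨j, hj⟩ := hTne
        exact biUnion_nonempty.2 ⟨j, hj, (hS j (mem_range.1 (hT hj))).2.1⟩
      · rw [prod_biUnion]
        · exact prod_le_prod (fun i _ => inf_le_left) hu
        · intro i hi j hj hij
          have hi' := mem_range.1 (hT hi)
          have hj' := mem_range.1 (hT hj)
          rcases lt_or_gt_of_ne hij with h | h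
          · exact (hdis j hj' i h).symm
          · exact hdis i hi' j h
    · intro j hj
      exact (hS j (mem_range.1 hj)).2.2.2

open scoped Classical in
theorem mem_of_exists_zero_sum {Γ V R ι : Type} [Group Γ] [AddCommGroup V]
    [CommRing R] [Algebra ℂ R] {π : Γ →* Multiplicative V} {φ : Γ →* (R →ₐ[ℂ] R)}
    (M : ι → Submodule ℂ R) (U : Finset ι) (χ : ι → AddChar V ℂ) (h : ℕ) (Z : Ideal R)
    (hZ : ∀ S ⊆ U, S.Nonempty → #S ≤ h → ∀ u ∈ ∏ i ∈ S, M i, (∀ γ, φ γ u = u) →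
      ∀ w ∈ ∏ i ∈ U \ S, M i, u * w ∈ Z)
    (hχ : ∃ S ⊆ U, S.Nonempty ∧ #S ≤ h ∧ ∑ i ∈ S, χ i = 0) :
    ∀ w ∈ ∏ i ∈ U, (M i ⊓ weightSpace π φ (χ i)), w ∈ Z := by
  obtain ⟨S, hS, hSne, hSc, h0⟩ := hχ
  refine prod_le_ideal _ U Z fun v hv => ?_
  rw [← prod_sdiff hS, mul_comm]
  refine hZ S hS hSne hSc _ (prod_mem_prod _ _ _ fun i hi => (hv i (hS hi)).1) ?_ _
    (prod_mem_prod _ _ _ fun i hi => (hv i (mem_sdiff.1 hi).1).1)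
  exact apply_eq_of_sum_eq_zero h0 (prod_mem_prod _ _ _ fun i hi => (hv i (hS hi)).2)

open scoped Classical in
theorem exists_short_zero_sum_addChar {p : ℕ} [Fact p.Prime] {ι : Type}
    (χ : ι → AddChar (ZMod p) ℂ) (h : ℕ) (U : Finset ι)
    (hp : p ≤ ∑ ξ : AddChar (ZMod p) ℂ, min (#{i ∈ U | χ i = ξ}) h) :
    ∃ S ⊆ U, S.Nonempty ∧ #S ≤ h ∧ ∑ i ∈ S, χ i = 0 := by
  set f : ZMod p ≃+ AddChar (ZMod p) ℂ := AddChar.zmodAddEquiv with hf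
  obtain ⟨S, hS, hne, hc, h0⟩ := exists_short_zero_sum (fun i => f.symm (χ i)) h U (by
    rw [← Equiv.sum_comp f.toEquiv] at hp
    refine hp.trans_eq (sum_congr rfl fun v _ => ?_)
    congr 2
    refine filter_congr fun i _ => ?_
    exact f.symm_apply_eq.symm)
  refine ⟨S, hS, hne, hc, f.symm.injective ?_⟩
  rw [map_sum, map_zero]
  exact h0

open scoped Classical in
theorem exists_heavy_fibre {ι κ : Type} [Fintype κ] (χ : ι → κ) (U : Finset ι) {p h k l : ℕ}
    (hlt : ∑ ξ : κ, min (#{i ∈ U | χ i = ξ}) h < p) (hk : p ≤ k * h) (hl : h < l)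
    (hU : p + (k - 1) * (l - 1 - h) ≤ #U) : ∃ ξ, l ≤ #{i ∈ U | χ i = ξ} := by
  by_contra! hcon
  set H : Finset κ := {ξ | h ≤ #{i ∈ U | χ i = ξ}} with hH
  have h1 : #U ≤ ∑ ξ : κ, (min (#{i ∈ U | χ i = ξ}) h + if ξ ∈ H then l - 1 - h else 0) := by
    rw [card_eq_sum_card_fiberwise (f := χ) (t := univ) (by simp)]
    refine sum_le_sum fun ξ _ => ?_
    have := hcon ξ
    by_cases hξ : ξ ∈ H
    · rw [if_pos hξ]
      have : h ≤ #{i ∈ U | χ i = ξ} := by simpa [hH] using hξ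
      rw [min_eq_right this]
      omega
    · rw [if_neg hξ]
      have : ¬ h ≤ #{i ∈ U | χ i = ξ} := by simpa [hH] using hξ
      rw [min_eq_left (by omega)]
      omega
  have h2 : #H * h ≤ ∑ ξ : κ, min (#{i ∈ U | χ i = ξ}) h := by
    rw [← smul_eq_mul, ← sum_const]
    refine (sum_le_sum fun ξ hξ => ?_).trans
      (sum_le_sum_of_subset (f := fun ξ => min (#{i ∈ U | χ i = ξ}) h) (subset_univ H))
    have : h ≤ #{i ∈ U | χ i = ξ} := by simpa [hH] using hξ
    exact le_min this le_rfl
  rw [sum_add_distrib, ← sum_filter, filter_mem_eq_inter, univ_inter, sum_const, smul_eq_mul] at h1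
  have h3 : #H < k := by
    by_contra! hc
    have := Nat.mul_le_mul_right h hc
    omega
  have h4 : #H * (l - 1 - h) ≤ (k - 1) * (l - 1 - h) := Nat.mul_le_mul_right _ (by omega)
  omega

section Twist

variable {G : Type} [Group G] {P : Subgroup G} [P.Normal] {p : ℕ}
  (e : P ≃* Multiplicative (ZMod p))

/-- Conjugation by `g` on a normal subgroup `P` identified with `ZMod p`. -/
noncomputable def conjHom (g : G) : ZMod p →+ ZMod p :=
  AddMonoidHom.toMultiplicative.symm
    (e.toMonoidHom.comp ((MulAut.conjNormal g : MulAut P).toMonoidHom.comp e.symm.toMonoidHom))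

theorem conjHom_apply (g : G) (x : P) :
    conjHom e g (e x).toAdd = (e (MulAut.conjNormal g x)).toAdd := by
  simp [conjHom]

/-- The twist of a character of `P` by an element of `G`. -/
noncomputable def twist (g : G) (χ : AddChar (ZMod p) ℂ) : AddChar (ZMod p) ℂ :=
  χ.compAddMonoidHom (conjHom e g⁻¹)

theorem twist_apply (g : G) (χ : AddChar (ZMod p) ℂ) (x : P) :
    twist e g χ (e x).toAdd = χ (e (MulAut.conjNormal g⁻¹ x)).toAdd := by
  rw [twist, AddChar.compAddMonoidHom_apply, conjHom_apply]

theorem addChar_zmod_injective [Fact p.Prime] {χ : AddChar (ZMod p) ℂ} (hχ : χ ≠ 0) :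
    Function.Injective χ := by
  have key : ∀ x, χ x = 1 → x = 0 := by
    intro x hx
    by_contra hne
    refine hχ (DFunLike.ext _ _ fun y => ?_)
    have h : y = (y * x⁻¹).val • x := by
      rw [nsmul_eq_mul, ZMod.natCast_zmod_val, inv_mul_cancel_right₀ hne]
    rw [h, AddChar.map_nsmul_eq_pow, hx, one_pow, AddChar.zero_apply]
  intro x y h
  refine sub_eq_zero.1 (key _ ?_)
  rw [AddChar.map_sub_eq_div, h, div_self (by
    intro h0
    have := χ.map_add_eq_mul y (-y)
    simp [h0] at this)]

theorem twist_injective [Fact p.Prime] {χ : AddChar (ZMod p) ℂ} (hχ : χ ≠ 0) {a b : G}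
    (h : twist e a χ = twist e b χ) :
    (QuotientGroup.mk a : G ⧸ Subgroup.centralizer (P : Set G)) = QuotientGroup.mk b := by
  rw [QuotientGroup.eq, Subgroup.mem_centralizer_iff]
  intro y hy
  have hy' : a * y * a⁻¹ ∈ P := Subgroup.Normal.conj_mem inferInstance y hy a
  have h1 := DFunLike.congr_fun h (e ⟨a * y * a⁻¹, hy'⟩).toAdd
  rw [twist_apply, twist_apply] at h1
  have h2 := e.injective (Multiplicative.toAdd.injective (addChar_zmod_injective hχ h1))
  have h3 := congrArg Subtype.val h2
  simp only [MulAut.conjNormal_apply, inv_inv] at h3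
  have h4 : y = b⁻¹ * (a * y * a⁻¹) * b := by
    rw [← h3]
    group
  have h5 : Commute y (b⁻¹ * a) := by
    change y * (b⁻¹ * a) = b⁻¹ * a * y
    conv_lhs => rw [h4]
    group
  simpa using h5.inv_right.eq

end Twist

section TwistedWeights

variable {G Γ R : Type} [Group G] [Group Γ] [CommRing R] [Algebra ℂ R] {P : Subgroup G}
  {p : ℕ} (e : P ≃* Multiplicative (ZMod p)) (π : Γ →* G) (φ : Γ →* (R →ₐ[ℂ] R))

/-- The weight spaces for the preimage of the normal subgroup `P`. -/
noncomputable def weight (χ : AddChar (ZMod p) ℂ) : Submodule ℂ R :=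
  weightSpace (e.toMonoidHom.comp (π.subgroupComap P)) (φ.comp (P.comap π).subtype) χ

variable {e π φ}

theorem mem_weight {χ : AddChar (ZMod p) ℂ} {r : R} :
    r ∈ weight e π φ χ ↔ ∀ γ, ∀ hγ : π γ ∈ P, φ γ r = χ (e ⟨π γ, hγ⟩).toAdd • r :=
  ⟨fun h γ hγ => h ⟨γ, hγ⟩, fun h γ => h γ.1 γ.2⟩

theorem apply_mem_weight [P.Normal] {χ : AddChar (ZMod p) ℂ} {r : R} (hr : r ∈ weight e π φ χ)
    (γ : Γ) : φ γ r ∈ weight e π φ (twist e (π γ) χ) := by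
  rw [mem_weight] at hr ⊢
  intro δ hδ
  have hδ' : π (γ⁻¹ * δ * γ) ∈ P := by
    simpa using Subgroup.Normal.conj_mem inferInstance _ hδ (π γ)⁻¹
  have h := hr (γ⁻¹ * δ * γ) hδ'
  have h1 : φ δ (φ γ r) = φ γ (φ (γ⁻¹ * δ * γ) r) := by
    rw [← AlgHom.mul_apply, ← AlgHom.mul_apply, ← map_mul, ← map_mul]
    congr 2
    group
  have h2 : (⟨π (γ⁻¹ * δ * γ), hδ'⟩ : P) = MulAut.conjNormal (π γ)⁻¹ ⟨π δ, hδ⟩ :=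
    Subtype.ext (by simp)
  rw [h1, h, map_smul, twist_apply, h2]

theorem twist_eq_self [P.Normal] {g : G} (hg : g ∈ Subgroup.centralizer (P : Set G))
    (χ : AddChar (ZMod p) ℂ) : twist e g χ = χ := by
  refine DFunLike.ext _ _ fun y => ?_
  obtain ⟨x, rfl⟩ : ∃ x, (e x).toAdd = y := ⟨e.symm (Multiplicative.ofAdd y), by simp⟩
  rw [twist_apply]
  congr 3
  refine Subtype.ext ?_
  rw [MulAut.conjNormal_apply, inv_inv, mul_assoc,
    Subgroup.mem_centralizer_iff.1 hg x x.2, inv_mul_cancel_left]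

theorem prod_inf_weight_fixed {ι : Type} (M : ι → Submodule ℂ R) {χ : AddChar (ZMod p) ℂ}
    {S : Finset ι} (hS : #S = p) {u : R} (hu : u ∈ ∏ i ∈ S, (M i ⊓ weight e π φ χ)) :
    u ∈ fixedBy φ (P.comap π) := by
  intro γ hγ
  refine apply_eq_of_sum_eq_zero (π := e.toMonoidHom.comp (π.subgroupComap P))
    (φ := φ.comp (P.comap π).subtype) (χ := fun _ => χ) ?_
    (prod_le_prod (fun i _ => inf_le_right) hu) ⟨γ, hγ⟩
  rw [sum_const, hS]
  refine DFunLike.ext _ _ fun y => ?_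
  rw [AddChar.nsmul_apply, ← AddChar.map_nsmul_eq_pow, nsmul_eq_mul]
  simp

open scoped Classical in
theorem mem_of_forall_grouped [P.Normal] {Q : Type} [Group Q] {t : ℕ}
    (hQ : CoinvariantBound Q t) (q : Subgroup.centralizer (P : Set G) →* Q)
    (hq : Function.Surjective q) (hqker : ∀ z, q z = 1 → z.1 ∈ P) (hπ : Function.Surjective π)
    {ι : Type} (M : ι → Submodule ℂ R) (hM : ∀ i γ, ∀ m ∈ M i, φ γ m ∈ M i)
    (χ : AddChar (ZMod p) ℂ) (U : Finset ι) (hU : t * p ≤ #U) (Z : Ideal R)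
    (hZ : ∀ S ⊆ U, p ≤ #S → #S ≤ t * p → ∀ u ∈ ∏ i ∈ S, (M i ⊓ weight e π φ χ),
      u ∈ fixedBy φ ((Subgroup.centralizer (P : Set G)).comap π) →
      ∀ w ∈ ∏ i ∈ U \ S, (M i ⊓ weight e π φ χ), u * w ∈ Z) :
    ∀ w ∈ ∏ i ∈ U, (M i ⊓ weight e π φ χ), w ∈ Z := by
  set N : ι → Submodule ℂ R := fun i => M i ⊓ weight e π φ χ with hN
  set Δ := (Subgroup.centralizer (P : Set G)).comap π with hΔ
  refine prod_le_ideal N U Z fun v hv => ?_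
  obtain ⟨U₀, hU₀, hc⟩ := exists_subset_card_eq hU
  let f : Fin t × Fin p ≃ U₀ := Fintype.equivOfCardEq (by simp [hc])
  set T : Fin t → Finset ι := fun j => univ.image fun k => (f (j, k) : ι) with hT
  have hTc : ∀ j, #(T j) = p := fun j => by
    rw [hT, card_image_of_injective, card_univ, Fintype.card_fin]
    intro k l hkl
    simpa using f.injective (Subtype.ext hkl)
  have hTU : ∀ j, T j ⊆ U₀ := fun j i hi => by
    obtain ⟨k, _, rfl⟩ := mem_image.1 hi
    exact (f (j, k)).2
  have hTd : ∀ j k, j ≠ k → Disjoint (T j) (T k) := fun j k hjk => by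
    refine disjoint_left.2 fun i hi hi' => hjk ?_
    obtain ⟨a, _, ha⟩ := mem_image.1 hi
    obtain ⟨b, _, hb⟩ := mem_image.1 hi'
    exact congrArg Prod.fst (f.injective (Subtype.ext (ha.trans hb.symm)))
  have hTun : univ.biUnion T = U₀ := by
    refine Subset.antisymm (biUnion_subset.2 fun j _ => hTU j) fun i hi => ?_
    obtain ⟨⟨j, k⟩, hjk⟩ := f.surjective ⟨i, hi⟩
    exact mem_biUnion.2 ⟨j, mem_univ _, mem_image.2 ⟨k, mem_univ _, by rw [hjk]⟩⟩
  have hpd : ∀ (J : Finset (Fin t)), Set.PairwiseDisjoint (J : Set (Fin t)) T :=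
    fun J a _ b _ hab => hTd a b hab
  rw [← prod_sdiff hU₀, mul_comm, ← hTun, prod_biUnion (hpd _), hTun]
  have hstab : ∀ i, ∀ γ ∈ Δ, ∀ m ∈ N i, φ γ m ∈ N i := by
    intro i γ hγ m hm
    refine ⟨hM i γ m hm.1, ?_⟩
    have := apply_mem_weight hm.2 γ
    rwa [twist_eq_self hγ] at this
  refine hQ.mem_of_forall_mul_mem (q.comp (π.subgroupComap (Subgroup.centralizer (P : Set G))))
    (hq.comp (π.subgroupComap_surjective_of_surjective _ hπ)) (φ.comp Δ.subtype)
    (fun j => ∏ i ∈ T j, N i) univ ?_ ?_ (by simp)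
    ((Z.restrictScalars ℂ).comap (LinearMap.mulRight ℂ (∏ i ∈ U \ U₀, v i))) ?_ _
    (fun j _ => prod_mem_prod _ _ _ fun i hi => hv i (hU₀ (hTU j hi)))
  · intro j γ m hm
    exact map_mem_prod _ (fun i _ => hstab i γ.1 γ.2) hm
  · intro j γ hγ m hm
    exact prod_inf_weight_fixed M (hTc j) hm _ (hqker _ hγ)
  · intro J _ hJ u hu hfix w hw
    change u * w * _ ∈ Z
    rw [mul_assoc]
    have hcard : #(J.biUnion T) = #J * p := by
      rw [card_biUnion (fun a _ b _ hab => hTd a b hab), sum_congr rfl fun j _ => hTc j,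
        sum_const, smul_eq_mul]
    refine hZ (J.biUnion T) ((biUnion_subset.2 fun j _ => hTU j).trans hU₀) ?_ ?_ u ?_
      (fun γ hγ => hfix ⟨γ, hγ⟩) _ ?_
    · rw [hcard]
      exact Nat.le_mul_of_pos_left _ hJ.card_pos
    · rw [hcard]
      exact Nat.mul_le_mul_right _ (by simpa using card_le_univ J)
    · rwa [prod_biUnion (hpd _)]
    · have : U \ J.biUnion T = (univ \ J).biUnion T ∪ (U \ U₀) := by
        ext i
        simp only [mem_sdiff, mem_union, mem_biUnion, mem_univ, true_and, not_exists, not_and]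
        constructor
        · rintro ⟨h1, h2⟩
          by_cases hi : i ∈ U₀
          · rw [← hTun] at hi
            obtain ⟨j, _, hj⟩ := mem_biUnion.1 hi
            exact Or.inl ⟨j, fun hjJ => h2 j hjJ hj, hj⟩
          · exact Or.inr ⟨h1, hi⟩
        · rintro (⟨j, hj, hi⟩ | ⟨h1, h2⟩)
          · exact ⟨hU₀ (hTU j hi), fun k hk hik => disjoint_left.1
              (hTd j k (by rintro rfl; exact hj hk)) hi hik⟩
          · exact ⟨h1, fun k _ hik => h2 (hTU k hik)⟩
      rw [this, prod_union, prod_biUnion (hpd _)]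
      · have hw' : w ∈ ∏ j ∈ univ \ J, ∏ i ∈ T j, N i := by convert hw
        exact Submodule.mul_mem_mul hw' (prod_mem_prod _ _ _ fun i hi => hv i (mem_sdiff.1 hi).1)
      · refine disjoint_left.2 fun i hi hi' => (mem_sdiff.1 hi').2 ?_
        obtain ⟨j, _, hj⟩ := mem_biUnion.1 hi
        exact hTU j hj

end TwistedWeights

open scoped Classical in
theorem prod_mul_mem_prod {R ι : Type} [CommRing R] [Algebra ℂ R] (N : ι → Submodule ℂ R)
    (U : Finset ι) (J : Finset ℕ) (S : ℕ → Finset ι) (hS : ∀ j ∈ J, S j ⊆ U)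
    (hd : (J : Set ℕ).PairwiseDisjoint S) (f : ℕ → R) (hf : ∀ j ∈ J, f j ∈ ∏ i ∈ S j, N i) {w : R}
    (hw : w ∈ ∏ i ∈ U \ J.biUnion S, N i) : (∏ j ∈ J, f j) * w ∈ ∏ i ∈ U, N i := by
  rw [← prod_sdiff (biUnion_subset.2 hS), mul_comm (∏ j ∈ J, f j)]
  refine Submodule.mul_mem_mul hw ?_
  rw [prod_biUnion hd]
  exact prod_mem_prod _ _ _ hf

section Methods

variable {G Γ R : Type} [Group G] [Group Γ] [CommRing R] [Algebra ℂ R] {P : Subgroup G}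
  {p : ℕ} [Fact p.Prime] {e : P ≃* Multiplicative (ZMod p)} {π : Γ →* G}
  {φ : Γ →* (R →ₐ[ℂ] R)}

open scoped Classical in
theorem mem_of_many_weights {ι : Type} (M : ι → Submodule ℂ R) (U : Finset ι) {h : ℕ}
    (Z : Ideal R)
    (hshort : ∀ S ⊆ U, S.Nonempty → #S ≤ h → ∀ u ∈ ∏ i ∈ S, M i, u ∈ fixedBy φ (P.comap π) →
      ∀ w ∈ ∏ i ∈ U \ S, M i, u * w ∈ Z) (χ : ι → AddChar (ZMod p) ℂ)
    (hχ : p ≤ ∑ ξ : AddChar (ZMod p) ℂ, min (#{i ∈ U | χ i = ξ}) h) :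
    ∀ w ∈ ∏ i ∈ U, (M i ⊓ weight e π φ (χ i)), w ∈ Z :=
  mem_of_exists_zero_sum M U χ h Z
    (fun S hS hne hc u hu hfix w hw => hshort S hS hne hc u hu (fun γ hγ => hfix ⟨γ, hγ⟩) w hw)
    (exists_short_zero_sum_addChar χ h U hχ)

open scoped Classical in
/-- Reduction to a large set of factors of the same nontrivial weight. -/
theorem mem_of_forall_heavy (hπ : Function.Surjective π) {ι : Type} (M : ι → Submodule ℂ R)
    (hM : ∀ i γ, ∀ m ∈ M i, φ γ m ∈ M i) (hker : ∀ i γ, π γ = 1 → ∀ m ∈ M i, φ γ m = m)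
    (U : Finset ι) {h k l : ℕ} (h1 : 1 ≤ h) (hk : p ≤ k * h) (hl : h < l)
    (hU : p + (k - 1) * (l - 1 - h) ≤ #U) (Z : Ideal R)
    (hshort : ∀ S ⊆ U, S.Nonempty → #S ≤ h → ∀ u ∈ ∏ i ∈ S, M i, u ∈ fixedBy φ (P.comap π) →
      ∀ w ∈ ∏ i ∈ U \ S, M i, u * w ∈ Z)
    (H : ∀ U₀ ⊆ U, l ≤ #U₀ → ∀ χ : AddChar (ZMod p) ℂ, χ ≠ 0 → ∀ c : R,
      (∀ χ' : ι → AddChar (ZMod p) ℂ,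
        p ≤ ∑ ξ : AddChar (ZMod p) ℂ, min (#{i ∈ U₀ | χ' i = ξ}) h →
        ∀ w ∈ ∏ i ∈ U₀, (M i ⊓ weight e π φ (χ' i)), c * w ∈ Z) →
      ∀ w ∈ ∏ i ∈ U₀, (M i ⊓ weight e π φ χ), c * w ∈ Z) :
    ∀ w ∈ ∏ i ∈ U, M i, w ∈ Z := by
  refine prod_mem_of_forall_weightSpace (V := ZMod p) (Γ := P.comap π)
    (π := e.toMonoidHom.comp (π.subgroupComap P))
    (e.surjective.comp (π.subgroupComap_surjective_of_surjective P hπ))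
    (φ := φ.comp (P.comap π).subtype) M U (fun i γ => hM i γ) ?_ Z fun χ => ?_
  · intro i γ hγ
    refine hker i γ ?_
    have : π.subgroupComap P γ = 1 := e.injective (hγ.trans (map_one e).symm)
    exact congrArg Subtype.val this
  change ∀ w ∈ ∏ i ∈ U, (M i ⊓ weight e π φ (χ i)), w ∈ Z
  by_cases hp : p ≤ ∑ ξ : AddChar (ZMod p) ℂ, min (#{i ∈ U | χ i = ξ}) h
  · exact mem_of_many_weights M U Z hshort χ hp
  obtain ⟨χ₀, hχ₀⟩ := exists_heavy_fibre χ U (not_le.1 hp) hk hl hU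
  set U₀ : Finset ι := {i ∈ U | χ i = χ₀} with hU₀
  have hsub : U₀ ⊆ U := filter_subset _ _
  have hval : ∀ i ∈ U₀, χ i = χ₀ := fun i hi => (mem_filter.1 hi).2
  by_cases h0 : χ₀ = 0
  · obtain ⟨i, hi⟩ := card_pos.1 (show 0 < #U₀ by omega)
    refine mem_of_exists_zero_sum M U χ h Z
      (fun S hS hne hc u hu hfix w hw =>
        hshort S hS hne hc u hu (fun γ hγ => hfix ⟨γ, hγ⟩) w hw)
      ⟨{i}, by simpa using hsub hi, by simp, by simpa using h1, ?_⟩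
    rw [sum_singleton, hval i hi, h0]
  refine prod_le_ideal _ U Z fun v hv => ?_
  rw [← prod_sdiff hsub]
  refine H U₀ hsub hχ₀ χ₀ h0 _ ?_ _ (prod_mem_prod _ _ _ fun i hi => ?_)
  · intro χ' hχ' w hw
    have hmem : (∏ i ∈ U \ U₀, v i) * w ∈
        ∏ i ∈ U, (M i ⊓ weight e π φ (if i ∈ U₀ then χ' i else χ i)) := by
      rw [← prod_sdiff hsub]
      refine Submodule.mul_mem_mul (prod_mem_prod _ _ _ fun i hi => ?_) ?_
      · rw [if_neg (mem_sdiff.1 hi).2]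
        exact hv i (mem_sdiff.1 hi).1
      · rwa [prod_congr rfl fun i hi => by rw [if_pos hi]]
    refine mem_of_many_weights M U Z hshort _ (hχ'.trans (sum_le_sum fun ξ _ => ?_)) _ hmem
    refine min_le_min_right _ (card_le_card fun i hi => ?_)
    rw [mem_filter] at hi ⊢
    exact ⟨hsub hi.1, by rw [if_pos hi.1]; exact hi.2⟩
  · have := hv i (hsub hi)
    rwa [hval i hi] at this

variable [P.Normal]

theorem twist_section_injective {χ : AddChar (ZMod p) ℂ} (hχ : χ ≠ 0)
    (hB : Function.Surjective ((QuotientGroup.mk' (Subgroup.centralizer (P : Set G))).comp π)) :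
    Function.Injective fun b => twist e (π (Function.surjInv hB b)) χ := by
  intro a b hab
  have := twist_injective e hχ hab
  rw [← Function.surjInv_eq hB a, ← Function.surjInv_eq hB b]
  exact this

theorem twist_section_one (χ : AddChar (ZMod p) ℂ)
    (hB : Function.Surjective ((QuotientGroup.mk' (Subgroup.centralizer (P : Set G))).comp π)) :
    twist e (π (Function.surjInv hB 1)) χ = χ :=
  twist_eq_self ((QuotientGroup.eq_one_iff _).1 (Function.surjInv_eq hB 1)) χ

theorem act_mem_prod_weight {ι : Type} {M : ι → Submodule ℂ R}
    (hM : ∀ i γ, ∀ m ∈ M i, φ γ m ∈ M i) {χ : AddChar (ZMod p) ℂ}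
    (hB : Function.Surjective ((QuotientGroup.mk' (Subgroup.centralizer (P : Set G))).comp π))
    {S : Finset ι} {u : R} (hu : u ∈ ∏ i ∈ S, (M i ⊓ weight e π φ χ)) (b) :
    act _ hB φ b u ∈
      ∏ i ∈ S, (M i ⊓ weight e π φ (twist e (π (Function.surjInv hB b)) χ)) := by
  refine prod_le_of_forall_prod_mem _ _ ((∏ i ∈ S, (M i ⊓ weight e π φ
    (twist e (π (Function.surjInv hB b)) χ))).comap (act _ hB φ b).toLinearMap)
    (fun v hv => ?_) hu
  change act _ hB φ b (∏ i ∈ S, v i) ∈ ∏ i ∈ S, (M i ⊓ weight e π φ _)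
  rw [map_prod]
  exact prod_mem_prod _ _ _ fun i hi => ⟨hM i _ _ (hv i hi).1, apply_mem_weight (hv i hi).2 _⟩

end Methods

open scoped Classical in
theorem shortBlocks_two {G : Type} [Group G] [Finite G] {P : Subgroup G} [P.Normal]
    {p : ℕ} [Fact p.Prime] (e : P ≃* Multiplicative (ZMod p)) {Q : Type} [Group Q] {t : ℕ}
    (hQ : CoinvariantBound Q t) (q : Subgroup.centralizer (P : Set G) →* Q)
    (hq : Function.Surjective q) (hqker : ∀ z, q z = 1 → z.1 ∈ P)
    {h : ℕ} (ht : 1 ≤ t) (hp : p ≤ 2 * h) (hp' : 2 * p ≤ 3 * h + 1) (hh : h ≤ p) :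
    ShortBlocks P h (p * t + h) := by
  intro Γ _ π hπ R _ _ φ ι M U hM hker hU Z hfixed hshort
  have hp2 := (Fact.out : p.Prime).two_le
  have htp : p ≤ p * t := Nat.le_mul_of_pos_right _ ht
  refine mem_of_forall_heavy (e := e) (l := p * t + 2 * h + 1 - p) hπ M hM hker U (by omega) hp
    (by omega) (by omega) Z hshort ?_
  intro U₀ hU₀ hc χ hχ c hmany
  refine mem_of_forall_grouped hQ q hq hqker hπ M hM χ U₀ (by rw [mul_comm]; omega)
    (Submodule.comap (LinearMap.mulLeft R c) Z) ?_
  intro S hS hSp hSt u hu hufix w hw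
  change c * (u * w) ∈ Z
  set πB := (QuotientGroup.mk' (Subgroup.centralizer (P : Set G))).comp π with hπB
  have hB : Function.Surjective πB := (QuotientGroup.mk'_surjective _).comp hπ
  have hk : ∀ γ, πB γ = 1 → φ γ u = u := fun γ hγ => hufix γ ((QuotientGroup.eq_one_iff (π γ)).1 hγ)
  have := Fintype.ofFinite (G ⧸ Subgroup.centralizer (P : Set G))
  have hsum : ∑ b, act πB hB φ b u ∈ Z := by
    refine hfixed S (hS.trans hU₀) (card_pos.1 (by omega)) _ (Submodule.sum_mem _ fun b _ => ?_)
      fun γ => apply_sum_act hB φ hk γ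
    exact map_mem_prod _ (fun i _ => hM i _) (prod_le_prod (fun i _ => inf_le_left) hu)
  rw [← add_sum_erase _ _ (mem_univ 1), act_one hB φ hk] at hsum
  have h1 : c * ((u + ∑ b ∈ univ.erase 1, act πB hB φ b u) * w) ∈ Z :=
    Z.mul_mem_left _ (Z.mul_mem_right _ hsum)
  rw [add_mul, mul_add, sum_mul, mul_sum] at h1
  refine (Ideal.add_mem_iff_left _ (Ideal.sum_mem _ fun b hb => ?_)).1 h1
  set χb := twist e (π (Function.surjInv hB b)) χ with hχb
  have hne : χb ≠ χ := by
    intro heq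
    refine (mem_erase.1 hb).1 (twist_section_injective (e := e) hχ hB ?_)
    exact heq.trans (twist_section_one χ hB).symm
  refine hmany (fun i => if i ∈ S then χb else χ) ?_ _ ?_
  · refine le_trans ?_ (sum_le_sum_of_subset (subset_univ {χb, χ}))
    rw [sum_pair hne]
    have e1 : #S ≤ #{i ∈ U₀ | (if i ∈ S then χb else χ) = χb} := card_le_card fun i hi => by
      rw [mem_filter, if_pos hi]
      exact ⟨hS hi, rfl⟩
    have e2 : #(U₀ \ S) ≤ #{i ∈ U₀ | (if i ∈ S then χb else χ) = χ} := card_le_card fun i hi => by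
      rw [mem_filter, if_neg (mem_sdiff.1 hi).2]
      exact ⟨(mem_sdiff.1 hi).1, rfl⟩
    rw [card_sdiff_of_subset hS] at e2
    rw [mul_comm] at hSt
    rw [min_eq_right (by omega)]
    have : p - h ≤ min (#{i ∈ U₀ | (if i ∈ S then χb else χ) = χ}) h :=
      le_min (by omega) (by omega)
    omega
  · rw [← prod_sdiff hS, mul_comm]
    refine Submodule.mul_mem_mul ?_ ?_
    · have hS' : ∏ i ∈ S, (M i ⊓ weight e π φ (if i ∈ S then χb else χ)) =
          ∏ i ∈ S, (M i ⊓ weight e π φ χb) := prod_congr rfl fun i hi => by rw [if_pos hi]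
      rw [hS']
      exact act_mem_prod_weight hM hB hu b
    · have hS' : ∏ i ∈ U₀ \ S, (M i ⊓ weight e π φ (if i ∈ S then χb else χ)) =
          ∏ i ∈ U₀ \ S, (M i ⊓ weight e π φ χ) :=
        prod_congr rfl fun i hi => by rw [if_neg (mem_sdiff.1 hi).2]
      rwa [hS']

open scoped Classical in
theorem shortBlocks_many {G : Type} [Group G] [Finite G] {P : Subgroup G} [P.Normal]
    {p : ℕ} [Fact p.Prime] (e : P ≃* Multiplicative (ZMod p)) {Q : Type} [Group Q] {t : ℕ}
    (hQ : CoinvariantBound Q t) (q : Subgroup.centralizer (P : Set G) →* Q)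
    (hq : Function.Surjective q) (hqker : ∀ z, q z = 1 → z.1 ∈ P)
    {h k : ℕ} (ht : 1 ≤ t) (hk : 2 ≤ k) (hp : p ≤ k * h) (h1 : 1 ≤ h) (hh : h < p) :
    ShortBlocks P h (p * ((k - 1) * ((k - 1) ^ 3 + 1) * t) + h) := by
  intro Γ _ π hπ R _ _ φ ι M U hM hker hU Z hfixed hshort
  obtain ⟨c₀, rfl⟩ : ∃ c₀, k = c₀ + 1 := ⟨k - 1, by omega⟩
  rw [Nat.add_sub_cancel] at hU
  set s := c₀ ^ 3 + 1 with hs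
  have htp : p ≤ s * (t * p) := by
    calc p ≤ t * p := Nat.le_mul_of_pos_left _ ht
      _ ≤ _ := Nat.le_mul_of_pos_left _ (by omega)
  refine mem_of_forall_heavy (e := e) (l := s * (t * p)) hπ M hM hker U (by omega) hp
    (by omega) ?_ Z hshort ?_
  · rw [Nat.add_sub_cancel]
    refine le_trans ?_ hU
    have e1 : p * (c₀ * s * t) = c₀ * (s * (t * p)) := by ring
    obtain ⟨r, hr⟩ : ∃ r, s * (t * p) = r + (1 + h) := ⟨s * (t * p) - (1 + h), by omega⟩
    rw [e1, hr, Nat.sub_sub, Nat.add_sub_cancel]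
    nlinarith
  intro U₀ hU₀ hc χ hχ c hmany
  set πB := (QuotientGroup.mk' (Subgroup.centralizer (P : Set G))).comp π with hπB
  have hB : Function.Surjective πB := (QuotientGroup.mk'_surjective _).comp hπ
  refine mem_of_forall_blocks (fun i => M i ⊓ weight e π φ χ)
    (fixedBy φ ((Subgroup.centralizer (P : Set G)).comap π)) (fun S => p ≤ #S)
    (fun j => j * (t * p)) s U₀ hc (Submodule.comap (LinearMap.mulLeft R c) Z) ?_ ?_
  · intro j _ V hV hVc Z' _ hZ'
    rw [add_mul, one_mul] at hVc
    refine mem_of_forall_grouped hQ q hq hqker hπ M hM χ V (by omega) Z' ?_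
    intro S hS hSp hSt u hu hufix w hw
    have hp2 := (Fact.out : p.Prime).two_le
    refine hZ' S hS (card_pos.1 (by omega)) hSp ?_ u hu hufix w hw
    rw [card_sdiff_of_subset hS]
    omega
  intro S u hS hdis w hw
  change c * ((∏ j ∈ range s, u j) * w) ∈ Z
  have hpd : ((range s : Finset ℕ) : Set ℕ).PairwiseDisjoint S := by
    intro i hi j hj hij
    have hi' := mem_range.1 hi
    have hj' := mem_range.1 hj
    rcases lt_or_gt_of_ne hij with h | h
    · exact (hdis j hj' i h).symm
    · exact hdis i hi' j h
  have hk : ∀ j ∈ range s, ∀ γ, πB γ = 1 → φ γ (u j) = u j := fun j hj γ hγ =>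
    (hS j (mem_range.1 hj)).2.2.2.2 γ ((QuotientGroup.eq_one_iff (π γ)).1 hγ)
  have := Fintype.ofFinite (G ⧸ Subgroup.centralizer (P : Set G))
  have hθ := eq_zero_of_translate_relations (c := c₀) (E := range s)
    (fun x : ℕ → G ⧸ Subgroup.centralizer (P : Set G) => Ideal.Quotient.mkₐ ℂ Z
      (c * ((∏ j ∈ range s, act πB hB φ (x j) (u j)) * w))) (by simp [hs]) ?_ 1 ?_
  · rw [Ideal.Quotient.mkₐ_eq_mk, Ideal.Quotient.eq_zero_iff_mem] at hθ
    rwa [prod_congr rfl fun j hj => (act_one hB φ (hk j hj)).symm]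
  · intro T hT hTne x
    rw [← map_sum, Ideal.Quotient.mkₐ_eq_mk, Ideal.Quotient.eq_zero_iff_mem, ← mul_sum, ← sum_mul]
    refine Z.mul_mem_left _ (Z.mul_mem_right _ ?_)
    refine sum_translate_mem hB φ (fun j => ∏ i ∈ S j, M i)
      (fun j γ m hm => map_mem_prod _ (fun i _ => hM i γ) hm) (range s) u
      (fun j hj => prod_le_prod (fun i _ => inf_le_left) (hS j (mem_range.1 hj)).2.2.2.1) hk Z T hT
      ?_ x
    intro u hu hfix
    refine hfixed (T.biUnion S) ?_ ?_ u ?_ hfix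
    · exact biUnion_subset.2 fun j hj => (hS j (mem_range.1 (hT hj))).1.trans hU₀
    · obtain ⟨j, hj⟩ := hTne
      exact biUnion_nonempty.2 ⟨j, hj, (hS j (mem_range.1 (hT hj))).2.1⟩
    · rwa [prod_biUnion (hpd.subset (by exact_mod_cast hT))]
  · intro x _ hx
    rw [Ideal.Quotient.mkₐ_eq_mk, Ideal.Quotient.eq_zero_iff_mem]
    set tw := fun b => twist e (π (Function.surjInv hB b)) χ with htw
    have htwi : Function.Injective tw := twist_section_injective hχ hB
    set χ' : ι → AddChar (ZMod p) ℂ := fun i =>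
      if hi : ∃ j ∈ range s, i ∈ S j then tw (x hi.choose) else χ with hχ'
    have hval : ∀ j ∈ range s, ∀ i ∈ S j, χ' i = tw (x j) := by
      intro j hj i hi
      have hex : ∃ j ∈ range s, i ∈ S j := ⟨j, hj, hi⟩
      have : hex.choose = j := by
        by_contra hne
        exact disjoint_left.1 (hpd hex.choose_spec.1 hj hne) hex.choose_spec.2 hi
      simp only [hχ', dif_pos hex, this]
    refine hmany χ' ?_ _ ?_
    · refine le_trans ?_ (sum_le_sum_of_subset (subset_univ ((range s).image fun j => tw (x j))))
      refine hp.trans ?_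
      have hcard : c₀ + 1 ≤ #((range s).image fun j => tw (x j)) := by
        rw [show (fun j => tw (x j)) = tw ∘ x from rfl, ← image_image,
          card_image_of_injective _ htwi]
        convert Nat.succ_le_of_lt hx
      refine (Nat.mul_le_mul_right h hcard).trans ?_
      rw [← smul_eq_mul, ← sum_const]
      refine sum_le_sum fun ξ hξ => le_min ?_ le_rfl
      obtain ⟨j, hj, rfl⟩ := mem_image.1 hξ
      refine hh.le.trans ((hS j (mem_range.1 hj)).2.2.1.trans (card_le_card fun i hi => ?_))
      exact mem_filter.2 ⟨(hS j (mem_range.1 hj)).1 hi, hval j hj i hi⟩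
    · refine prod_mul_mem_prod _ U₀ (range s) S (fun j hj => (hS j (mem_range.1 hj)).1) hpd _
        (fun j hj => ?_) ?_
      · have hS' : ∏ i ∈ S j, (M i ⊓ weight e π φ (χ' i)) =
            ∏ i ∈ S j, (M i ⊓ weight e π φ (tw (x j))) :=
          prod_congr rfl fun i hi => by rw [hval j hj i hi]
        rw [hS']
        exact act_mem_prod_weight hM hB (hS j (mem_range.1 hj)).2.2.2.1 (x j)
      · rwa [prod_congr rfl fun i hi => by
          rw [show χ' i = χ from dif_neg fun ⟨j, hj, hij⟩ =>
            (mem_sdiff.1 hi).2 (mem_biUnion.2 ⟨j, hj, hij⟩)]]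

theorem card_quotient_centralizer_lt {G : Type} [Group G] [Finite G] {P : Subgroup G} [P.Normal]
    {p : ℕ} [hp : Fact p.Prime] (hP : Nat.card P = p) :
    Nat.card (G ⧸ Subgroup.centralizer (P : Set G)) < p := by
  have : IsCyclic P := isCyclic_of_prime_card hP
  have hker : (MulAut.conjNormal : G →* MulAut P).ker = Subgroup.centralizer (P : Set G) := by
    ext g
    rw [MonoidHom.mem_ker, Subgroup.mem_centralizer_iff, MulEquiv.ext_iff]
    refine ⟨fun h x hx => ?_, fun h x => Subtype.ext ?_⟩
    · have := congrArg Subtype.val (h ⟨x, hx⟩)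
      rw [MulAut.conjNormal_apply] at this
      exact (mul_inv_eq_iff_eq_mul.1 this).symm
    · rw [MulAut.conjNormal_apply, ← h x x.2, mul_inv_cancel_right]
      rfl
  have h1 : Nat.card (G ⧸ Subgroup.centralizer (P : Set G)) ≤ Nat.card (MulAut P) := by
    rw [← hker]
    exact Nat.card_le_card_of_injective _ (QuotientGroup.kerLift_injective _)
  rw [IsCyclic.card_mulAut, hP, Nat.totient_prime hp.out] at h1
  have := hp.out.pos
  omega

theorem small_index_estimate {m : ℕ} (h3 : 3 ≤ m) (hm : m < 243) :
    m * (m + 4) ^ 10 ≤ (2 * (m + 1)) ^ 10 := by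
  revert h3
  revert m
  decide +kernel

/-- Numerical optimization of the bound for `m ≥ 3`. -/
theorem exists_block_parameters {m p : ℕ} (hm : 3 ≤ m) (hmp : m < p) :
    ∃ k h a : ℕ, 2 ≤ k ∧ p ≤ k * h ∧ 1 ≤ h ∧ h < p ∧ a = (k - 1) * ((k - 1) ^ 3 + 1) ∧ a ≤ m ∧
      (p * a + h * (m - a)) ^ 10 ≤ p ^ 10 * m ^ 9 := by
  have key : ∀ k a : ℕ, 2 ≤ k → a = (k - 1) * ((k - 1) ^ 3 + 1) → a ≤ m →
      (∀ f, k * f ≤ p * (a * k) + (p + (k - 1)) * (m - a) → f ^ 10 ≤ p ^ 10 * m ^ 9) →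
      ∃ k h a : ℕ, 2 ≤ k ∧ p ≤ k * h ∧ 1 ≤ h ∧ h < p ∧ a = (k - 1) * ((k - 1) ^ 3 + 1) ∧ a ≤ m ∧
        (p * a + h * (m - a)) ^ 10 ≤ p ^ 10 * m ^ 9 := by
    intro k a hk ha ham hf
    have h1 : k * ((p + (k - 1)) / k) ≤ p + (k - 1) := Nat.mul_div_le _ _
    have h2 : p + (k - 1) < k * ((p + (k - 1)) / k + 1) := Nat.lt_mul_div_succ _ (by omega)
    rw [mul_add, mul_one] at h2
    generalize (p + (k - 1)) / k = h at h1 h2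
    have hph : p ≤ k * h := by
      generalize k * h = n at h1 h2
      omega
    refine ⟨k, h, a, hk, hph, ?_, ?_, ha, ham, hf _ ?_⟩
    · by_contra h0
      rw [show h = 0 by omega, mul_zero] at hph
      omega
    · by_contra h0
      obtain ⟨j, rfl⟩ : ∃ j, k = j + 2 := ⟨k - 2, by omega⟩
      have h1 : (j + 2) * h ≤ p + (j + 1) := h1
      nlinarith
    · calc k * (p * a + h * (m - a)) = p * (a * k) + k * h * (m - a) := by ring
        _ ≤ _ := by gcongr
  by_cases hA : m < 243
  · refine key 2 2 le_rfl (by norm_num) (by omega) fun f hf => ?_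
    have h1 : 2 * (m + 1) * f ≤ p * (m * (m + 4)) := by
      obtain ⟨j, rfl⟩ : ∃ j, m = j + 2 := ⟨m - 2, by omega⟩
      rw [Nat.add_sub_cancel] at hf
      nlinarith
    refine le_of_mul_le_mul_left ?_ (show 0 < (2 * (m + 1)) ^ 10 by positivity)
    calc (2 * (m + 1)) ^ 10 * f ^ 10 = (2 * (m + 1) * f) ^ 10 := (mul_pow _ _ _).symm
      _ ≤ (p * (m * (m + 4))) ^ 10 := by gcongr
      _ = p ^ 10 * m ^ 9 * (m * (m + 4) ^ 10) := by ring
      _ ≤ p ^ 10 * m ^ 9 * (2 * (m + 1)) ^ 10 := by gcongr; exact small_index_estimate hm hA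
      _ = _ := by ring
  by_cases hB : m < 3125
  · refine key 3 18 (by norm_num) (by norm_num) (by omega) fun f hf => ?_
    have h1 : 18 * f ≤ 7 * (p * m) := by
      obtain ⟨j, rfl⟩ : ∃ j, m = j + 18 := ⟨m - 18, by omega⟩
      rw [Nat.add_sub_cancel] at hf
      nlinarith
    refine le_of_mul_le_mul_left ?_ (show 0 < 18 ^ 10 by positivity)
    calc 18 ^ 10 * f ^ 10 = (18 * f) ^ 10 := by rw [mul_pow]
      _ ≤ (7 * (p * m)) ^ 10 := by gcongr
      _ = p ^ 10 * m ^ 9 * (7 ^ 10 * m) := by ring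
      _ ≤ p ^ 10 * m ^ 9 * 18 ^ 10 := by gcongr; omega
      _ = _ := by ring
  set k := Nat.nthRoot 5 m with hk
  have hk1 : k ^ 5 ≤ m := Nat.pow_nthRoot_le (Or.inl (by norm_num))
  have hk2 : m < (k + 1) ^ 5 := Nat.lt_pow_nthRoot_add_one (by norm_num) m
  have hk5 : 5 ≤ k := by
    by_contra h
    have : (k + 1) ^ 5 ≤ 5 ^ 5 := by gcongr; omega
    omega
  clear_value k
  obtain ⟨j, rfl⟩ : ∃ j, k = j + 1 := ⟨k - 1, by omega⟩
  have ha : (j * (j ^ 3 + 1) + 1) * j + j ≤ (j + 1) ^ 5 := by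
    ring_nf
    nlinarith [sq_nonneg j]
  have ham : j * (j ^ 3 + 1) ≤ m := by nlinarith
  refine key (j + 1) _ (by omega) rfl (by simpa using ham) fun f hf => ?_
  rw [Nat.add_sub_cancel] at hf
  set a := j * (j ^ 3 + 1)
  have h1 : (j + 1) * f ≤ 2 * (p * m) := by
    obtain ⟨r, rfl⟩ : ∃ r, m = a + r := ⟨m - a, by omega⟩
    rw [Nat.add_sub_cancel_left] at hf
    have h2 : j * r ≤ j * p := by gcongr; omega
    have h3 : p * (a * j + j) ≤ p * (a + r) := Nat.mul_le_mul_left p (by nlinarith)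
    nlinarith
  refine le_of_mul_le_mul_left ?_ (show 0 < (j + 1) ^ 10 by positivity)
  calc (j + 1) ^ 10 * f ^ 10 = ((j + 1) * f) ^ 10 := by rw [mul_pow]
    _ ≤ (2 * (p * m)) ^ 10 := by gcongr
    _ = p ^ 10 * m ^ 9 * (2 ^ 10 * m) := by ring
    _ ≤ p ^ 10 * m ^ 9 * (j + 1) ^ 10 := by
        gcongr
        calc 2 ^ 10 * m ≤ 2 ^ 10 * (j + 1 + 1) ^ 5 := by gcongr
          _ = (4 * (j + 2)) ^ 5 := by ring
          _ ≤ ((j + 1) ^ 2) ^ 5 := by gcongr; nlinarith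
          _ = _ := by ring
    _ = _ := by ring

/-- A quotient of a subgroup containing `P`, seen as a kernel on `G ⧸ P`. -/
noncomputable def mulEquivKerMap {G Q : Type} [Group G] [Group Q] (P Y : Subgroup G) [P.Normal]
    [Y.Normal] (hPY : P ≤ Y) (q : Y →* Q) (hq : Function.Surjective q)
    (hqker : ∀ z, q z = 1 ↔ z.1 ∈ P) :
    Q ≃* (QuotientGroup.map P Y (MonoidHom.id G) hPY).ker := by
  have hmem : ∀ y : Y, (QuotientGroup.mk' P).comp Y.subtype y ∈
      (QuotientGroup.map P Y (MonoidHom.id G) hPY).ker := fun y =>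
    (QuotientGroup.eq_one_iff y.1).2 y.2
  let ψ := ((QuotientGroup.mk' P).comp Y.subtype).codRestrict _ hmem
  have hψ : Function.Surjective ψ := by
    rintro ⟨x, hx⟩
    obtain ⟨g, rfl⟩ := QuotientGroup.mk_surjective x
    exact ⟨⟨g, (QuotientGroup.eq_one_iff g).1 hx⟩, rfl⟩
  have hker : q.ker = ψ.ker := by
    ext z
    rw [MonoidHom.mem_ker, MonoidHom.mem_ker, hqker, Subtype.ext_iff]
    exact (QuotientGroup.eq_one_iff z.1).symm
  exact (QuotientGroup.quotientKerEquivOfSurjective q hq).symm.trans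
    ((QuotientGroup.quotientMulEquivOfEq hker).trans
      (QuotientGroup.quotientKerEquivOfSurjective ψ hψ))

/-- The bound for a group with a normal subgroup of prime order, in terms of the centralizer of
that subgroup. -/
theorem exists_coinvariantBound_of_prime_normal {G : Type} [Group G] [Finite G] (P : Subgroup G)
    [P.Normal] {p : ℕ} [hp : Fact p.Prime] (hP : Nat.card P = p) {Q : Type} [Group Q] {t : ℕ}
    (ht : 1 ≤ t) (hQ : CoinvariantBound Q t) (q : Subgroup.centralizer (P : Set G) →* Q)
    (hq : Function.Surjective q) (hqker : ∀ z, q z = 1 ↔ z.1 ∈ P) :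
    ∃ f, 1 ≤ f ∧ CoinvariantBound G (t * f) ∧
      f ^ 10 ≤ p ^ 10 * Nat.card (G ⧸ Subgroup.centralizer (P : Set G)) ^ 9 := by
  have hmp := card_quotient_centralizer_lt hP
  have hPc : CoinvariantBound P p := hP ▸ coinvariantBound_card P
  have hPY : P ≤ Subgroup.centralizer (P : Set G) := by
    have : IsCyclic P := isCyclic_of_prime_card hP
    exact Subgroup.le_centralizer_iff_isMulCommutative.2 inferInstance
  obtain ⟨e⟩ : Nonempty (P ≃* Multiplicative (ZMod p)) := by
    have : IsCyclic P := isCyclic_of_prime_card hP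
    exact ⟨mulEquivOfCyclicCardEq (by simp [hP])⟩
  have hm0 : 0 < Nat.card (G ⧸ Subgroup.centralizer (P : Set G)) := Nat.card_pos
  have hGP : CoinvariantBound (G ⧸ P)
      (t * Nat.card (G ⧸ Subgroup.centralizer (P : Set G))) := by
    refine CoinvariantBound.mul (QuotientGroup.map P (Subgroup.centralizer (P : Set G)) (MonoidHom.id G) hPY)
      (QuotientGroup.map_surjective_of_surjective _ _ _ QuotientGroup.mk_surjective hPY)
      (hQ.congr (mulEquivKerMap P _ hPY q hq hqker)) (coinvariantBound_card _)
  set m := Nat.card (G ⧸ Subgroup.centralizer (P : Set G))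
  have hp2 := hp.out.two_le
  rcases lt_or_ge m 3 with h3 | h3
  · obtain h | h : m = 1 ∨ m = 2 := by omega
    · refine ⟨p, by omega, ?_, by simp [h]⟩
      rw [h, mul_one] at hGP
      rw [mul_comm]
      refine CoinvariantBound.mul (QuotientGroup.mk' P) (QuotientGroup.mk'_surjective P) ?_ hGP
      rwa [QuotientGroup.ker_mk']
    · have hS := shortBlocks_two e hQ q hq (fun z => (hqker z).1) (h := (2 * p + 1) / 3) ht
        (by omega) (by omega) (by omega)
      refine ⟨p + (2 * p + 1) / 3, by omega, ?_, ?_⟩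
      · convert coinvariantBound_of_shortBlocks P hPc hGP (by rw [h]; omega) hS using 1
        rw [h, show t * 2 - t = t by omega]
        ring
      · rw [h]
        refine le_of_mul_le_mul_left ?_ (show 0 < 9 ^ 10 by positivity)
        calc 9 ^ 10 * (p + (2 * p + 1) / 3) ^ 10 = (9 * (p + (2 * p + 1) / 3)) ^ 10 := by
              rw [mul_pow]
          _ ≤ (16 * p) ^ 10 := Nat.pow_le_pow_left (by omega) 10
          _ = 16 ^ 10 * p ^ 10 := by ring
          _ ≤ 9 ^ 10 * 2 ^ 9 * p ^ 10 := by gcongr; norm_num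
          _ = _ := by ring
  · obtain ⟨k, h, a, hk, hkh, h1, hh, ha, ham, hf⟩ := exists_block_parameters h3 hmp
    have hS := shortBlocks_many e hQ q hq (fun z => (hqker z).1) ht hk hkh h1 hh
    rw [← ha] at hS
    have ha0 : 0 < a := ha ▸ Nat.mul_pos (by omega) (Nat.succ_pos _)
    have hp0 := hp.out.pos
    refine ⟨p * a + h * (m - a), Nat.succ_le_of_lt (by positivity), ?_, hf⟩
    convert coinvariantBound_of_shortBlocks P hPc hGP ?_ hS using 1
    · rw [mul_comm t m, ← Nat.sub_mul]
      ring
    · rw [mul_comm t]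
      gcongr

end NoetherBound

namespace NoetherBound

open Finset MvPolynomial

section Invariants

variable {G : Type} [Group G] {n : ℕ} (ρ : Representation ℂ G (Fin n → ℂ))

theorem polySubst_one : ρ.polySubst 1 = AlgHom.id ℂ _ := by
  refine algHom_ext fun i => ?_
  simp [Representation.polySubst, Pi.single_apply]

theorem polySubst_mul (g h : G) :
    ρ.polySubst (g * h) = (ρ.polySubst h).comp (ρ.polySubst g) := by
  refine algHom_ext fun i => ?_
  simp only [Representation.polySubst, map_mul, aeval_X, AlgHom.comp_apply, map_sum,
    LinearMap.toMatrix'_mul, Matrix.mul_apply, sum_mul, mul_sum, mul_assoc,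
    aeval_C, algebraMap_eq]
  rw [sum_comm]

/-- The action of `G` on polynomials. -/
noncomputable def polyAct : G →* (MvPolynomial (Fin n) ℂ →ₐ[ℂ] MvPolynomial (Fin n) ℂ) where
  toFun g := ρ.polySubst g⁻¹
  map_one' := by rw [inv_one, polySubst_one]; rfl
  map_mul' g h := by rw [mul_inv_rev, polySubst_mul]; rfl

theorem mem_invariantAlgebra {f : MvPolynomial (Fin n) ℂ} :
    f ∈ ρ.invariantAlgebra ↔ ∀ g, polyAct ρ g f = f := by
  rw [Representation.invariantAlgebra, Algebra.mem_iInf]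
  exact ⟨fun h g => h g⁻¹, fun h g => by simpa [polyAct] using h g⁻¹⟩

theorem polyAct_isHomogeneous (g : G) {f : MvPolynomial (Fin n) ℂ} {k : ℕ}
    (hf : f.IsHomogeneous k) : (polyAct ρ g f).IsHomogeneous k := by
  have := hf.aeval (fun i => ∑ j, C (LinearMap.toMatrix' (ρ g⁻¹) i j) * X j) (n := 1)
    (fun i => IsHomogeneous.sum _ _ _ fun j _ => isHomogeneous_C_mul_X _ _)
  rwa [one_mul] at this

theorem polyAct_homogeneousComponent (g : G) (f : MvPolynomial (Fin n) ℂ) (k : ℕ) :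
    polyAct ρ g (homogeneousComponent k f) = homogeneousComponent k (polyAct ρ g f) := by
  conv_rhs => rw [← sum_homogeneousComponent f, map_sum, map_sum]
  have : ∀ i, homogeneousComponent k (polyAct ρ g (homogeneousComponent i f)) =
      if k = i then polyAct ρ g (homogeneousComponent k f) else 0 := by
    intro i
    rw [homogeneousComponent_of_mem
      (polyAct_isHomogeneous ρ g (homogeneousComponent_isHomogeneous i f))]
    split_ifs with h
    · rw [h]
    · rfl
  simp only [this, sum_ite_eq, mem_range]
  split_ifs with h
  · rfl
  · rw [homogeneousComponent_eq_zero _ _ (by omega), map_zero]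

theorem sum_polyAct_mem [Fintype G] (f : MvPolynomial (Fin n) ℂ) :
    ∑ g, polyAct ρ g f ∈ ρ.invariantAlgebra := by
  refine (mem_invariantAlgebra ρ).2 fun h => ?_
  rw [map_sum]
  refine Fintype.sum_equiv (Equiv.mulLeft h) _ _ fun g => ?_
  rw [Equiv.coe_mulLeft, map_mul]
  rfl

variable {ρ} in
theorem mem_adjoin_of_isHomogeneous [Finite G] {d : ℕ} (h : CoinvariantBound G d) (k : ℕ) :
    ∀ f : MvPolynomial (Fin n) ℂ, f.IsHomogeneous k → f ∈ ρ.invariantAlgebra →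
      f ∈ Algebra.adjoin ℂ {f : MvPolynomial (Fin n) ℂ |
        f ∈ ρ.invariantAlgebra ∧ f.totalDegree ≤ d} := by
  have := Fintype.ofFinite G
  set 𝒜 := Algebra.adjoin ℂ {f : MvPolynomial (Fin n) ℂ |
        f ∈ ρ.invariantAlgebra ∧ f.totalDegree ≤ d} with h𝒜
  induction k using Nat.strong_induction_on with
  | _ k ih =>
  intro f hf hinv
  rcases le_or_gt k d with hkd | hkd
  · exact Algebra.subset_adjoin ⟨hinv, hf.totalDegree_le.trans hkd⟩
  set Z : Ideal (MvPolynomial (Fin n) ℂ) := Ideal.span {u | u ∈ ρ.invariantAlgebra ∧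
    ∃ j, 1 ≤ j ∧ j ≤ d ∧ u.IsHomogeneous j} with hZ
  have hd : ∀ w ∈ homogeneousSubmodule (Fin n) ℂ d, w ∈ Z := by
    have := prod_le_ideal (fun _ : ℕ => homogeneousSubmodule (Fin n) ℂ 1) (range d) Z
      (h G (MonoidHom.id G) Function.surjective_id _ (polyAct ρ) ℕ _ _
        (fun i γ m hm => polyAct_isHomogeneous ρ γ hm)
        (fun i γ hγ m hm => by rw [show γ = 1 from hγ, map_one]; rfl) (by simp) Z
        fun S hS hne u hu hfix => ?_)
    · rwa [prod_const, card_range, homogeneousSubmodule_one_pow] at this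
    · rw [prod_const, homogeneousSubmodule_one_pow] at hu
      refine Ideal.subset_span ⟨(mem_invariantAlgebra ρ).2 hfix, #S, hne.card_pos, ?_, hu⟩
      simpa using card_le_card hS
  have hfZ : f ∈ Z := by
    have hk : homogeneousSubmodule (Fin n) ℂ k =
        homogeneousSubmodule (Fin n) ℂ (k - d) * homogeneousSubmodule (Fin n) ℂ d := by
      rw [← homogeneousSubmodule_one_pow ℂ k, ← homogeneousSubmodule_one_pow ℂ (k - d),
        ← homogeneousSubmodule_one_pow ℂ d, ← pow_add, Nat.sub_add_cancel hkd.le]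
    have hf' : f ∈ homogeneousSubmodule (Fin n) ℂ k := hf
    rw [hk] at hf'
    refine Submodule.mul_induction_on hf' (fun a _ b hb => Z.mul_mem_left _ (hd b hb))
      fun a b ha hb => Z.add_mem ha hb
  have key : ∀ x ∈ Z, ∀ r, ∑ g, polyAct ρ g (homogeneousComponent k (r * x)) ∈ 𝒜 := by
    intro x hx
    induction hx using Submodule.span_induction with
    | zero => simp [𝒜.zero_mem]
    | add x y _ _ hx hy =>
      intro r
      simp only [mul_add, map_add, sum_add_distrib]
      exact 𝒜.add_mem (hx r) (hy r)
    | smul a x _ hx =>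
      intro r
      rw [smul_eq_mul, ← mul_assoc]
      exact hx _
    | mem x hx =>
      obtain ⟨hxinv, j, hj1, hjd, hxj⟩ := hx
      intro r
      rw [← sum_homogeneousComponent r, sum_mul]
      simp only [map_sum]
      rw [sum_comm]
      refine 𝒜.sum_mem fun i _ => ?_
      rw [homogeneousComponent_of_mem ((homogeneousComponent_isHomogeneous i r).mul hxj)]
      split_ifs with hij
      · simp only [map_mul, (mem_invariantAlgebra ρ).1 hxinv]
        rw [← sum_mul]
        refine 𝒜.mul_mem (ih i (by omega) _ (IsHomogeneous.sum _ _ _ fun g _ =>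
          polyAct_isHomogeneous ρ g (homogeneousComponent_isHomogeneous i r))
          (sum_polyAct_mem ρ _)) (Algebra.subset_adjoin ⟨hxinv, hxj.totalDegree_le.trans hjd⟩)
      · simp [𝒜.zero_mem]
  have h1 := key f hfZ 1
  rw [one_mul, homogeneousComponent_eq_self hf] at h1
  simp only [(mem_invariantAlgebra ρ).1 hinv, sum_const, card_univ] at h1
  rw [← Nat.cast_smul_eq_nsmul ℂ] at h1
  have h2 := 𝒜.smul_mem h1 (Fintype.card G : ℂ)⁻¹
  rwa [inv_smul_smul₀ (by simp)] at h2

end Invariants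

theorem noetherNumber_le_of_coinvariantBound {G : Type} [Group G] [Finite G] {d : ℕ}
    (h : CoinvariantBound G d) : noetherNumber G ≤ d := by
  refine Nat.sInf_le fun n ρ => le_antisymm (Algebra.adjoin_le fun f hf => hf.1) fun f hf => ?_
  rw [← sum_homogeneousComponent f]
  refine Subalgebra.sum_mem _ fun k _ => mem_adjoin_of_isHomogeneous h k _
    (homogeneousComponent_isHomogeneous k f) ((mem_invariantAlgebra ρ).2 fun g => ?_)
  rw [polyAct_homogeneousComponent, (mem_invariantAlgebra ρ).1 hf]

end NoetherBound

namespace NoetherBound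

theorem elementary_estimate {p k : ℕ} (hp : 2 ≤ p) (hk : 2 ≤ k) :
    (k * (p - 1) + 1) ^ 10 ≤ (p ^ k) ^ 8 := by
  obtain ⟨r, rfl⟩ : ∃ r, p = r + 1 := ⟨p - 1, by omega⟩
  rw [Nat.add_sub_cancel]
  suffices h : (k * r + 1) ^ 5 ≤ (r + 1) ^ (4 * k) by
    calc (k * r + 1) ^ 10 = ((k * r + 1) ^ 5) ^ 2 := by ring
      _ ≤ ((r + 1) ^ (4 * k)) ^ 2 := Nat.pow_le_pow_left h 2
      _ = _ := by ring
  induction k, hk using Nat.le_induction with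
  | base =>
    obtain h | h | h : r = 1 ∨ r = 2 ∨ 3 ≤ r := by omega
    · subst h; norm_num
    · subst h; norm_num
    · calc (2 * r + 1) ^ 5 ≤ (2 * (r + 1)) ^ 5 := Nat.pow_le_pow_left (by omega) 5
        _ = 32 * (r + 1) ^ 5 := by ring
        _ ≤ (r + 1) ^ 3 * (r + 1) ^ 5 := by
          gcongr
          calc 32 ≤ 4 ^ 3 := by norm_num
            _ ≤ (r + 1) ^ 3 := Nat.pow_le_pow_left (by omega) 3
        _ = _ := by ring
  | succ k hk ih =>
    have h1 : 2 * ((k + 1) * r + 1) ≤ 3 * (k * r + 1) := by nlinarith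
    refine le_of_mul_le_mul_left ?_ (show 0 < 2 ^ 5 by positivity)
    calc 2 ^ 5 * ((k + 1) * r + 1) ^ 5 = (2 * ((k + 1) * r + 1)) ^ 5 := (mul_pow _ _ _).symm
      _ ≤ (3 * (k * r + 1)) ^ 5 := Nat.pow_le_pow_left h1 5
      _ = 243 * (k * r + 1) ^ 5 := by ring
      _ ≤ 2 ^ 5 * 2 ^ 4 * (r + 1) ^ (4 * k) := by gcongr; norm_num
      _ ≤ 2 ^ 5 * (r + 1) ^ 4 * (r + 1) ^ (4 * k) := by gcongr
      _ = _ := by ring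

theorem coinvariantBound_of_pow_eq_one {K : Type} [CommGroup K] [Finite K] {p k : ℕ}
    [Fact p.Prime] (hK : ∀ x : K, x ^ p = 1) (hcard : Nat.card K = p ^ k) :
    CoinvariantBound K (k * (p - 1) + 1) :=
  (coinvariantBound_elementary (V := Additive K) (p := p) (k := k) (fun x => hK x.toMul)
    hcard).congr (MulEquiv.refl K : Multiplicative (Additive K) ≃* K)

theorem orderOf_linearMap_le_card {F V : Type} [Field F] [Finite F] [AddCommGroup V] [Module F V]
    [Finite V] (α : Module.End F V) : orderOf α ≤ Nat.card V := by
  rw [Module.natCard_eq_pow_finrank (K := F)]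
  have hmem : ∀ n, Polynomial.X ^ n %ₘ α.charpoly ∈
      Polynomial.degreeLT F (Module.finrank F V) := fun n => by
    rw [Polynomial.mem_degreeLT, ← α.charpoly_natDegree,
      ← Polynomial.degree_eq_natDegree α.charpoly_monic.ne_zero]
    exact Polynomial.degree_modByMonic_lt _ α.charpoly_monic
  have heval : ∀ n, Polynomial.aeval α (Polynomial.X ^ n %ₘ α.charpoly) = α ^ n := fun n => by
    rw [Polynomial.aeval_modByMonic_eq_self_of_root α.aeval_self_charpoly, map_pow,
      Polynomial.aeval_X]
  have := Fintype.ofFinite F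
  have hinj : Function.Injective fun n : Fin (orderOf α) =>
      Polynomial.degreeLTEquiv F _ ⟨_, hmem n⟩ := by
    intro a b hab
    have h1 := congrArg Subtype.val ((Polynomial.degreeLTEquiv F _).injective hab)
    have h2 : α ^ (a : ℕ) = α ^ (b : ℕ) := by
      rw [← heval, ← heval]
      exact congrArg _ h1
    exact Fin.ext (pow_injOn_Iio_orderOf a.2 b.2 h2)
  simpa [Nat.card_eq_fintype_card] using Fintype.card_le_of_injective _ hinj

theorem orderOf_addMonoidEnd_le_card_of_smul (F : Type) {V : Type} [Field F] [Finite F]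
    [AddCommGroup V] [Module F V] [Finite V]
    (h : ∀ (α : AddMonoid.End V) (c : F) (x : V), α (c • x) = c • α x)
    (α : AddMonoid.End V) : orderOf α ≤ Nat.card V := by
  let f : AddMonoid.End V →* Module.End F V :=
    { toFun := fun α => { toFun := α, map_add' := map_add α, map_smul' := h α }
      map_one' := rfl
      map_mul' := fun _ _ => rfl }
  have hf : Function.Injective f := fun a b hab =>
    AddMonoidHom.ext fun x => DFunLike.congr_fun hab x
  rw [← orderOf_injective f hf]
  exact orderOf_linearMap_le_card (f α)

theorem orderOf_addAut_le_card {V : Type} [AddCommGroup V] [Finite V] {p : ℕ} [Fact p.Prime]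
    (hV : ∀ x : V, p • x = 0) (α : AddMonoid.End V) : orderOf α ≤ Nat.card V :=
  letI : Module (ZMod p) V := AddCommGroup.zmodModule hV
  orderOf_addMonoidEnd_le_card_of_smul (ZMod p) (fun α c x => ZMod.map_smul α c x) α

theorem orderOf_mulAut_le_card {K : Type} [CommGroup K] [Finite K] {p : ℕ} [Fact p.Prime]
    (hK : ∀ x : K, x ^ p = 1) (α : MulAut K) : orderOf α ≤ Nat.card K := by
  let f : MulAut K →* AddMonoid.End (Additive K) :=
    { toFun := fun α => MonoidHom.toAdditive α.toMonoidHom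
      map_one' := rfl
      map_mul' := fun _ _ => rfl }
  have hf : Function.Injective f := fun a b hab => MulEquiv.ext fun x =>
    congrArg Additive.toMul (DFunLike.congr_fun hab (Additive.ofMul x))
  rw [← orderOf_injective f hf]
  exact orderOf_addAut_le_card (V := Additive K) (p := p) (fun x => hK x.toMul) (f α)

section Torsion

variable {G : Type} [Group G]

/-- The subgroup of elements of order dividing `n` in an abelian subgroup. -/
def torsionSubgroup (A : Subgroup G) (hA : ∀ x ∈ A, ∀ y ∈ A, x * y = y * x) (n : ℕ) :
    Subgroup G where
  carrier := {x | x ∈ A ∧ x ^ n = 1}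
  one_mem' := ⟨A.one_mem, one_pow n⟩
  mul_mem' := fun {x y} hx hy => ⟨A.mul_mem hx.1 hy.1, by
    rw [(show Commute x y from hA x hx.1 y hy.1).mul_pow, hx.2, hy.2, one_mul]⟩
  inv_mem' := fun {x} hx => ⟨A.inv_mem hx.1, by rw [inv_pow, hx.2, inv_one]⟩

variable {A : Subgroup G} (hA : ∀ x ∈ A, ∀ y ∈ A, x * y = y * x)

theorem mem_of_characteristic {H : Subgroup G} (hH : H.Characteristic) (φ : G ≃* G) {x : G}
    (hx : x ∈ H) : φ x ∈ H :=
  Subgroup.characteristic_iff_map_le.1 hH φ (Subgroup.mem_map_of_mem φ.toMonoidHom hx)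

theorem characteristic_of_forall_mem {H : Subgroup G} (h : ∀ φ : G ≃* G, ∀ x ∈ H, φ x ∈ H) :
    H.Characteristic :=
  Subgroup.characteristic_iff_map_le.2 fun φ => Subgroup.map_le_iff_le_comap.2 (h φ)

theorem torsionSubgroup_characteristic (hchar : A.Characteristic) (n : ℕ) :
    (torsionSubgroup A hA n).Characteristic :=
  characteristic_of_forall_mem fun φ x hx =>
    ⟨mem_of_characteristic hchar φ hx.1, by rw [← map_pow, hx.2, map_one]⟩

theorem card_torsionSubgroup_mul_le [Finite G] (m n : ℕ) :
    Nat.card (torsionSubgroup A hA (m * n)) ≤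
      Nat.card (torsionSubgroup A hA m) * Nat.card (torsionSubgroup A hA n) := by
  let f : torsionSubgroup A hA (m * n) →* torsionSubgroup A hA m :=
    { toFun := fun x => ⟨x.1 ^ n, A.pow_mem x.2.1 n, by
        rw [← pow_mul, mul_comm n m, x.2.2]⟩
      map_one' := Subtype.ext (one_pow n)
      map_mul' := fun x y => Subtype.ext
        ((show Commute x.1 y.1 from hA _ x.2.1 _ y.2.1).mul_pow n) }
  rw [← f.ker.card_mul_index, mul_comm, Subgroup.index_ker]
  refine Nat.mul_le_mul (Subgroup.card_le_card_group _) ?_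
  refine Nat.card_le_card_of_injective
    (fun x => ⟨x.1.1, x.1.2.1, congrArg Subtype.val x.2⟩) fun x y hxy => ?_
  exact Subtype.ext (Subtype.ext (Subtype.mk.inj hxy))

theorem card_le_of_isCyclic_of_pow_eq_one {K : Type} [Group K] [IsCyclic K] {n : ℕ} (hn : 0 < n)
    (h : ∀ x : K, x ^ n = 1) : Nat.card K ≤ n := by
  obtain ⟨g, hg⟩ := IsCyclic.exists_ofOrder_eq_natCard (α := K)
  exact hg ▸ orderOf_le_of_pow_eq_one hn (h g)

theorem isCyclic_of_forall_isCyclic_torsionSubgroup [Finite G]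
    (h : ∀ p : ℕ, p.Prime → IsCyclic (torsionSubgroup A hA p)) : IsCyclic A := by
  classical
  have hcard : ∀ n, 0 < n → Nat.card (torsionSubgroup A hA n) ≤ n := by
    intro n
    induction n using Nat.recOnMul with
    | zero => simp
    | one =>
      intro _
      refine (Subgroup.card_le_one_iff_eq_bot _).2 ((Subgroup.eq_bot_iff_forall _).2 fun x hx => ?_)
      simpa using hx.2
    | prime p hp =>
      intro _
      have := h p hp
      exact card_le_of_isCyclic_of_pow_eq_one hp.pos fun x => Subtype.ext x.2.2
    | mul a b ha hb =>
      intro hab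
      have ha' := ha (Nat.pos_of_mul_pos_right hab)
      have hb' := hb (Nat.pos_of_mul_pos_left hab)
      exact (card_torsionSubgroup_mul_le hA a b).trans (Nat.mul_le_mul ha' hb')
  have := Fintype.ofFinite A
  refine isCyclic_of_card_pow_eq_one_le fun n hn => ?_
  refine le_trans ?_ (hcard n hn)
  rw [← Fintype.card_subtype, ← Nat.card_eq_fintype_card]
  refine Nat.card_le_card_of_injective
    (fun x => ⟨x.1.1, x.1.2, congrArg Subtype.val x.2⟩) fun x y hxy => ?_
  exact Subtype.ext (Subtype.ext (Subtype.mk.inj hxy))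

end Torsion

section CyclicBound

/-- The tenth power of some bound for the coinvariants of `G` is at most `|C| |G| ^ 9` for a
characteristic cyclic subgroup `C`. -/
def CyclicBound (G : Type) [Group G] : Prop :=
  ∃ (C : Subgroup G) (d : ℕ), C.Characteristic ∧ IsCyclic C ∧ 1 ≤ d ∧ CoinvariantBound G d ∧
    d ^ 10 ≤ Nat.card C * Nat.card G ^ 9

theorem isCyclic_of_surjective_of_ker_le {A B D : Type} [Group A] [Group B] [Group D] [IsCyclic D]
    (f : A →* B) (hf : Function.Surjective f) (g : A →* D) (h : g.ker ≤ f.ker) : IsCyclic B := by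
  obtain ⟨⟨_, a, rfl⟩, ha⟩ := IsCyclic.exists_generator (α := g.range)
  refine ⟨f a, fun b => ?_⟩
  obtain ⟨x, rfl⟩ := hf b
  obtain ⟨n, hn⟩ := ha ⟨g x, x, rfl⟩
  have hn' : g a ^ n = g x := congrArg Subtype.val hn
  have hmem : x⁻¹ * a ^ n ∈ f.ker := h (by
    rw [MonoidHom.mem_ker, map_mul, map_inv, map_zpow, hn', inv_mul_cancel])
  refine ⟨n, ?_⟩
  rw [MonoidHom.mem_ker, map_mul, map_inv, map_zpow] at hmem
  exact (inv_mul_eq_one.1 hmem).symm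

section Powers

variable {G : Type} [Group G]

/-- The subgroup of `n`-th powers of elements of an abelian subgroup. -/
def powerSubgroup (A : Subgroup G) (hA : ∀ x ∈ A, ∀ y ∈ A, x * y = y * x) (n : ℕ) :
    Subgroup G where
  carrier := {y | ∃ x ∈ A, x ^ n = y}
  one_mem' := ⟨1, A.one_mem, one_pow n⟩
  mul_mem' := by
    rintro _ _ ⟨x, hx, rfl⟩ ⟨y, hy, rfl⟩
    exact ⟨x * y, A.mul_mem hx hy, (show Commute x y from hA x hx y hy).mul_pow n⟩
  inv_mem' := by
    rintro _ ⟨x, hx, rfl⟩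
    exact ⟨x⁻¹, A.inv_mem hx, inv_pow x n⟩

variable {A : Subgroup G} (hA : ∀ x ∈ A, ∀ y ∈ A, x * y = y * x)

theorem powerSubgroup_characteristic (hchar : A.Characteristic) (n : ℕ) :
    (powerSubgroup A hA n).Characteristic :=
  characteristic_of_forall_mem fun φ _ ⟨x, hx, h⟩ =>
    ⟨φ x, mem_of_characteristic hchar φ hx, by rw [← map_pow, h]⟩

/-- The power map from an abelian subgroup onto the subgroup of powers. -/
def toPowerSubgroup (n : ℕ) : A →* powerSubgroup A hA n where
  toFun x := ⟨x.1 ^ n, x.1, x.2, rfl⟩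
  map_one' := Subtype.ext (one_pow n)
  map_mul' x y := Subtype.ext ((show Commute x.1 y.1 from hA _ x.2 _ y.2).mul_pow n)

theorem toPowerSubgroup_surjective (n : ℕ) : Function.Surjective (toPowerSubgroup hA n) := by
  rintro ⟨_, x, hx, rfl⟩
  exact ⟨⟨x, hx⟩, rfl⟩

theorem mem_ker_toPowerSubgroup {n : ℕ} {x : A} :
    x ∈ (toPowerSubgroup hA n).ker ↔ x.1 ^ n = 1 := by
  rw [MonoidHom.mem_ker, Subtype.ext_iff]
  rfl

theorem card_torsionSubgroup_mul_card_powerSubgroup (n : ℕ) :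
    Nat.card (torsionSubgroup A hA n) * Nat.card (powerSubgroup A hA n) = Nat.card A := by
  have hker : Nat.card (toPowerSubgroup hA n).ker = Nat.card (torsionSubgroup A hA n) :=
    Nat.card_congr
      { toFun := fun x => ⟨x.1.1, x.1.2, (mem_ker_toPowerSubgroup hA).1 x.2⟩
        invFun := fun x => ⟨⟨x.1, x.2.1⟩, (mem_ker_toPowerSubgroup hA).2 x.2.2⟩
        left_inv := fun _ => rfl
        right_inv := fun _ => rfl }
  rw [← (toPowerSubgroup hA n).ker.card_mul_index, Subgroup.index_ker, hker,
    MonoidHom.range_eq_top.2 (toPowerSubgroup_surjective hA n), Subgroup.card_top]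

end Powers

variable {G : Type} [Group G] [Finite G]

/-- A cyclic group acting by conjugation on an elementary abelian normal subgroup `K` has
an image of order at most `|K|`. -/
theorem card_le_card_inf_centralizer_mul {p : ℕ} [Fact p.Prime] (K D : Subgroup G) [K.Normal]
    (hKcomm : ∀ x ∈ K, ∀ y ∈ K, x * y = y * x) (hKp : ∀ x ∈ K, x ^ p = 1)
    {E : Type} [Group E] [IsCyclic E] (q : D →* E) (hq : ∀ x, q x = 1 → x.1 ∈ K) :
    Nat.card D ≤ Nat.card (D ⊓ Subgroup.centralizer (K : Set G) : Subgroup G) * Nat.card K := by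
  let inst : CommGroup K :=
    { (inferInstance : Group K) with
      mul_comm := fun x y => Subtype.ext (hKcomm _ x.2 _ y.2) }
  let f : D →* MulAut K := MulAut.conjNormal.comp D.subtype
  have hf : ∀ x, x ∈ f.ker ↔ x.1 ∈ Subgroup.centralizer (K : Set G) := by
    intro x
    rw [MonoidHom.mem_ker, Subgroup.mem_centralizer_iff]
    constructor
    · intro h y hy
      have := congrArg Subtype.val (DFunLike.congr_fun h (⟨y, hy⟩ : K))
      have h2 : x.1 * y * x.1⁻¹ = y := this
      rw [mul_inv_eq_iff_eq_mul] at h2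
      exact h2.symm
    · intro h
      refine MulEquiv.ext fun y => Subtype.ext ?_
      change x.1 * y.1 * x.1⁻¹ = y.1
      rw [mul_inv_eq_iff_eq_mul]
      exact (h y.1 y.2).symm
  have hker : Nat.card f.ker =
      Nat.card (D ⊓ Subgroup.centralizer (K : Set G) : Subgroup G) :=
    Nat.card_congr
      { toFun := fun x => ⟨x.1.1, x.1.2, (hf _).1 x.2⟩
        invFun := fun x => ⟨⟨x.1, x.2.1⟩, (hf _).2 x.2.2⟩
        left_inv := fun _ => rfl
        right_inv := fun _ => rfl }
  have hle : q.ker ≤ f.rangeRestrict.ker := fun x hx => by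
    rw [MonoidHom.ker_rangeRestrict, hf, Subgroup.mem_centralizer_iff]
    exact fun y hy => hKcomm y hy x.1 (hq x hx)
  have hcyc := isCyclic_of_surjective_of_ker_le f.rangeRestrict f.rangeRestrict_surjective q hle
  obtain ⟨α, hα⟩ := IsCyclic.exists_ofOrder_eq_natCard (α := f.range)
  rw [← f.ker.card_mul_index, Subgroup.index_ker, hker, ← hα, ← Subgroup.orderOf_coe]
  exact Nat.mul_le_mul_left _
    (orderOf_mulAut_le_card (p := p) (fun x : K => Subtype.ext (hKp x.1 x.2)) α.1)

theorem cyclicBound_of_not_isCyclic {p : ℕ} [hp : Fact p.Prime] (K : Subgroup G) [K.Characteristic]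
    (hKcomm : ∀ x ∈ K, ∀ y ∈ K, x * y = y * x) (hKp : ∀ x ∈ K, x ^ p = 1) (hK : ¬ IsCyclic K)
    (hmax : ∀ L : Subgroup G, L.Characteristic → (∀ x ∈ L, ∀ y ∈ L, x * y = y * x) →
      (∀ x ∈ L, x ^ p = 1) → K ≤ L → L ≤ K)
    (ih : CyclicBound (G ⧸ K)) : CyclicBound G := by
  obtain ⟨D', d, hD'char, hD'cyc, hd1, hd, hle⟩ := ih
  obtain ⟨k, hk⟩ : ∃ k, Nat.card K = p ^ k :=
    IsPGroup.iff_card.1 fun x => ⟨1, by rw [pow_one]; exact Subtype.ext (hKp x.1 x.2)⟩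
  have hk2 : 2 ≤ k := by
    by_contra hlt
    obtain rfl | rfl : k = 0 ∨ k = 1 := by omega
    · have : Subsingleton K := (Nat.card_eq_one_iff_unique.1 (by simpa using hk)).1
      exact hK isCyclic_of_subsingleton
    · exact hK (isCyclic_of_prime_card (by simpa using hk))
  have hKbound : CoinvariantBound K (k * (p - 1) + 1) :=
    letI : CommGroup K :=
      { (inferInstance : Group K) with
        mul_comm := fun x y => Subtype.ext (hKcomm _ x.2 _ y.2) }
    coinvariantBound_of_pow_eq_one (fun x => Subtype.ext (hKp x.1 x.2)) hk
  have hG : CoinvariantBound G ((k * (p - 1) + 1) * d) :=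
    CoinvariantBound.mul (QuotientGroup.mk' K) (QuotientGroup.mk'_surjective K)
      (by rwa [QuotientGroup.ker_mk']) hd
  set D := D'.comap (QuotientGroup.mk' K) with hD
  have hDchar : D.Characteristic := Subgroup.Characteristic.comap_quotient_mk hD'char
  have hKD : K ≤ D := fun x hx => by
    rw [hD, Subgroup.mem_comap, QuotientGroup.mk'_apply, (QuotientGroup.eq_one_iff x).2 hx]
    exact D'.one_mem
  let q : D →* D' := (QuotientGroup.mk' K).subgroupComap D'
  have hqsurj : Function.Surjective q :=
    MonoidHom.subgroupComap_surjective_of_surjective _ _ (QuotientGroup.mk'_surjective K)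
  have hq : ∀ x, q x = 1 ↔ x.1 ∈ K := fun x => by
    rw [← QuotientGroup.eq_one_iff, Subtype.ext_iff]
    rfl
  set M := D ⊓ Subgroup.centralizer (K : Set G) with hM
  have hMchar : M.Characteristic := inferInstance
  have hKM : K ≤ M := le_inf hKD fun x hx =>
    Subgroup.mem_centralizer_iff.2 fun y hy => hKcomm y hy x hx
  let qM : M →* D' := q.comp (Subgroup.inclusion inf_le_left)
  have hqM : ∀ x, x ∈ qM.ker ↔ x.1 ∈ K := fun x => hq (Subgroup.inclusion inf_le_left x)
  have hMcomm : ∀ x ∈ M, ∀ y ∈ M, x * y = y * x := by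
    have : IsMulCommutative M := qM.isMulCommutative_of_isCyclic_of_ker_le_center fun x hx =>
      Subgroup.mem_center_iff.2 fun y => Subtype.ext
        ((Subgroup.mem_centralizer_iff.1 y.2.2 x.1 ((hqM x).1 hx)).symm)
    exact fun x hx y hy => congrArg Subtype.val (this.is_comm.comm (⟨x, hx⟩ : M) ⟨y, hy⟩)
  have htors : torsionSubgroup M hMcomm p = K := by
    have h1 : K ≤ torsionSubgroup M hMcomm p := fun x hx => ⟨hKM hx, hKp x hx⟩
    exact le_antisymm (hmax _ (torsionSubgroup_characteristic hMcomm hMchar p)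
      (fun x hx y hy => hMcomm x hx.1 y hy.1) (fun x hx => hx.2) h1) h1
  have hcardM := card_torsionSubgroup_mul_card_powerSubgroup hMcomm p
  rw [htors] at hcardM
  have hCcyc : IsCyclic (powerSubgroup M hMcomm p) :=
    isCyclic_of_surjective_of_ker_le _ (toPowerSubgroup_surjective hMcomm p) qM fun x hx =>
      (mem_ker_toPowerSubgroup hMcomm).2 (hKp _ ((hqM x).1 hx))
  have hcardD : Nat.card D = Nat.card K * Nat.card D' := by
    have hker : Nat.card q.ker = Nat.card K := Nat.card_congr
      { toFun := fun x => ⟨x.1.1, (hq _).1 x.2⟩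
        invFun := fun x => ⟨⟨x.1, hKD x.2⟩, (hq _).2 x.2⟩
        left_inv := fun _ => rfl
        right_inv := fun _ => rfl }
    rw [← q.ker.card_mul_index, Subgroup.index_ker, hker, MonoidHom.range_eq_top.2 hqsurj,
      Subgroup.card_top]
  have hDle := card_le_card_inf_centralizer_mul (p := p) K D hKcomm hKp q fun x => (hq x).1
  rw [← hM] at hDle
  have hKpos : 0 < Nat.card K := Nat.card_pos
  have hD'le : Nat.card D' ≤ Nat.card K * Nat.card (powerSubgroup M hMcomm p) := by
    rw [hcardM]
    exact Nat.le_of_mul_le_mul_left (by rw [← hcardD, mul_comm (Nat.card K)]; exact hDle) hKpos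
  refine ⟨powerSubgroup M hMcomm p, (k * (p - 1) + 1) * d,
    powerSubgroup_characteristic hMcomm hMchar p, hCcyc, Nat.mul_pos (Nat.succ_pos _) hd1, hG, ?_⟩
  have hcardG : Nat.card G = Nat.card K * Nat.card (G ⧸ K) := by
    rw [← K.card_mul_index]
    rfl
  calc ((k * (p - 1) + 1) * d) ^ 10 = (k * (p - 1) + 1) ^ 10 * d ^ 10 := mul_pow _ _ _
    _ ≤ Nat.card K ^ 8 * (Nat.card D' * Nat.card (G ⧸ K) ^ 9) := by
      refine Nat.mul_le_mul ?_ hle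
      rw [hk]
      exact elementary_estimate hp.out.two_le hk2
    _ ≤ Nat.card K ^ 8 * (Nat.card K * Nat.card (powerSubgroup M hMcomm p) *
        Nat.card (G ⧸ K) ^ 9) := by gcongr
    _ = _ := by rw [hcardG]; ring

end CyclicBound

section Induction

variable {G : Type} [Group G]

/-- The preimage in `G` of a characteristic subgroup of `Y / P`, where `P` and `Y` are
characteristic in `G`, is characteristic. -/
theorem characteristic_map_comap_mk' (P Y : Subgroup G) (hP : P.Characteristic)
    (hY : Y.Characteristic) [(P.subgroupOf Y).Normal] {D : Subgroup (Y ⧸ P.subgroupOf Y)}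
    (hD : D.Characteristic) :
    ((D.comap (QuotientGroup.mk' (P.subgroupOf Y))).map Y.subtype).Characteristic := by
  refine characteristic_of_forall_mem fun φ => ?_
  rintro _ ⟨x, hx, rfl⟩
  let ψ : Y ≃* Y := (φ.subgroupMap Y).trans
    (MulEquiv.subgroupCongr (Subgroup.characteristic_iff_map_eq.1 hY φ))
  have hψ : (P.subgroupOf Y).map (ψ : Y →* Y) = P.subgroupOf Y := by
    refine le_antisymm ?_ fun y hy => ?_
    · rintro _ ⟨y, hy, rfl⟩
      exact mem_of_characteristic hP φ (x := y.1) hy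
    · exact ⟨⟨φ.symm y.1, mem_of_characteristic hY φ.symm y.2⟩,
        mem_of_characteristic hP φ.symm (x := y.1) hy, Subtype.ext (φ.apply_symm_apply y.1)⟩
  exact ⟨ψ x, mem_of_characteristic hD (QuotientGroup.congr _ _ ψ hψ) hx, rfl⟩

variable [Finite G]

theorem cyclicBound_of_prime {p : ℕ} [hp : Fact p.Prime] (P : Subgroup G) [hPchar : P.Characteristic]
    (hP : Nat.card P = p)
    (hcyc : ∀ (r : ℕ) (L : Subgroup G), r.Prime → L.Characteristic →
      (∀ x ∈ L, ∀ y ∈ L, x * y = y * x) → (∀ x ∈ L, x ^ r = 1) → IsCyclic L)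
    (ih : CyclicBound
      (Subgroup.centralizer (P : Set G) ⧸ P.subgroupOf (Subgroup.centralizer (P : Set G)))) :
    CyclicBound G := by
  set Y := Subgroup.centralizer (P : Set G) with hY
  obtain ⟨D', t, hD'char, hD'cyc, ht1, ht, hle⟩ := ih
  have hYchar : Y.Characteristic := inferInstance
  have hPcyc : IsCyclic P := isCyclic_of_prime_card hP
  have hPY : P ≤ Y := Subgroup.le_centralizer_iff_isMulCommutative.2 inferInstance
  set N := P.subgroupOf Y with hN
  obtain ⟨f, hf1, hf, hfle⟩ := exists_coinvariantBound_of_prime_normal P hP ht1 ht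
    (QuotientGroup.mk' N) (QuotientGroup.mk'_surjective N) fun z => by
      rw [QuotientGroup.mk'_apply, QuotientGroup.eq_one_iff]
      rfl
  set D₁ := D'.comap (QuotientGroup.mk' N) with hD₁
  let q : D₁ →* D' := (QuotientGroup.mk' N).subgroupComap D'
  have hqsurj : Function.Surjective q :=
    MonoidHom.subgroupComap_surjective_of_surjective _ _ (QuotientGroup.mk'_surjective N)
  have hq : ∀ x, q x = 1 ↔ x.1.1 ∈ P := fun x => by
    have : q x = 1 ↔ (x.1 : Y ⧸ N) = 1 := Subtype.ext_iff
    rw [this, QuotientGroup.eq_one_iff]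
    rfl
  have hDchar := characteristic_map_comap_mk' P Y hPchar hYchar hD'char
  have hDcomm : ∀ x ∈ D₁.map Y.subtype, ∀ y ∈ D₁.map Y.subtype, x * y = y * x := by
    have : IsMulCommutative D₁ := q.isMulCommutative_of_isCyclic_of_ker_le_center fun x hx =>
      Subgroup.mem_center_iff.2 fun y => Subtype.ext (Subtype.ext
        ((Subgroup.mem_centralizer_iff.1 y.1.2 x.1.1 ((hq x).1 hx)).symm))
    rintro _ ⟨x, hx, rfl⟩ _ ⟨y, hy, rfl⟩
    exact congrArg (fun z : D₁ => z.1.1) (this.is_comm.comm (⟨x, hx⟩ : D₁) ⟨y, hy⟩)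
  have hDcyc : IsCyclic (D₁.map Y.subtype) :=
    isCyclic_of_forall_isCyclic_torsionSubgroup hDcomm fun r hr =>
      hcyc r _ hr (torsionSubgroup_characteristic hDcomm hDchar r)
        (fun x hx y hy => hDcomm x hx.1 y hy.1) fun x hx => hx.2
  have hcardD : Nat.card (D₁.map Y.subtype) = p * Nat.card D' := by
    have hker : Nat.card q.ker = Nat.card P := Nat.card_congr
      { toFun := fun x => ⟨x.1.1.1, (hq _).1 x.2⟩
        invFun := fun x =>
          have hx : (⟨x.1, hPY x.2⟩ : Y) ∈ D₁ := by
            rw [hD₁, Subgroup.mem_comap, QuotientGroup.mk'_apply,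
              (QuotientGroup.eq_one_iff (⟨x.1, hPY x.2⟩ : Y)).2 x.2]
            exact D'.one_mem
          ⟨⟨⟨x.1, hPY x.2⟩, hx⟩, (hq _).2 x.2⟩
        left_inv := fun _ => rfl
        right_inv := fun _ => rfl }
    rw [Subgroup.card_map_of_injective Y.subtype_injective, ← q.ker.card_mul_index,
      Subgroup.index_ker, hker, MonoidHom.range_eq_top.2 hqsurj, Subgroup.card_top, hP]
  have hcardG : Nat.card G = p * Nat.card (Y ⧸ N) * Nat.card (G ⧸ Y) := by
    have h1 : Nat.card N = p := by
      rw [← hP, hN, Nat.card_congr (Subgroup.subgroupOfEquivOfLe hPY).toEquiv]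
    have h2 := N.card_mul_index
    rw [h1] at h2
    rw [← Y.card_mul_index, ← h2]
    rfl
  refine ⟨D₁.map Y.subtype, t * f, hDchar, hDcyc, Nat.mul_pos ht1 hf1, hf, ?_⟩
  calc (t * f) ^ 10 = t ^ 10 * f ^ 10 := mul_pow _ _ _
    _ ≤ Nat.card D' * Nat.card (Y ⧸ N) ^ 9 * (p ^ 10 * Nat.card (G ⧸ Y) ^ 9) :=
      Nat.mul_le_mul hle hfle
    _ = _ := by rw [hcardD, hcardG]; ring

/-- A nontrivial finite solvable group has a nontrivial characteristic elementary abelian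
subgroup. -/
theorem exists_characteristic_elementary [Nontrivial G] (hG : Group.IsSolvable G) :
    ∃ (p : ℕ) (P : Subgroup G), p.Prime ∧ P.Characteristic ∧
      (∀ x ∈ P, ∀ y ∈ P, x * y = y * x) ∧ (∀ x ∈ P, x ^ p = 1) ∧ P ≠ ⊥ := by
  classical
  have hex := hG.solvable
  obtain ⟨n, hn⟩ : ∃ n, Nat.find hex = n + 1 := by
    refine Nat.exists_eq_succ_of_ne_zero fun h0 => ?_
    have := Nat.find_spec hex
    rw [h0, derivedSeries_zero] at this
    exact top_ne_bot this
  have hbot : derivedSeries G (n + 1) = ⊥ := hn ▸ Nat.find_spec hex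
  have hne : derivedSeries G n ≠ ⊥ := Nat.find_min hex (by omega)
  have hA : ∀ x ∈ derivedSeries G n, ∀ y ∈ derivedSeries G n, x * y = y * x := fun x hx y hy => by
    rw [derivedSeries_succ, Subgroup.commutator_eq_bot_iff_le_centralizer] at hbot
    exact Subgroup.mem_centralizer_iff.1 (hbot hy) x hx
  have hcard : Nat.card (derivedSeries G n) ≠ 1 := fun h => hne (Subgroup.card_eq_one.1 h)
  have hp := Nat.minFac_prime hcard
  have := Fact.mk hp
  obtain ⟨x, hx⟩ := exists_prime_orderOf_dvd_card' (G := derivedSeries G n) _ (Nat.minFac_dvd _)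
  refine ⟨_, torsionSubgroup _ hA (Nat.minFac (Nat.card (derivedSeries G n))), hp,
    torsionSubgroup_characteristic hA (derivedSeries_characteristic G n) _,
    fun x hx y hy => hA x hx.1 y hy.1, fun x hx => hx.2, fun h => ?_⟩
  have hmem : x.1 ∈ torsionSubgroup _ hA (Nat.minFac (Nat.card (derivedSeries G n))) :=
    ⟨x.2, by rw [← hx, ← Subgroup.orderOf_coe]; exact pow_orderOf_eq_one _⟩
  rw [h, Subgroup.mem_bot] at hmem
  have h1 : x = 1 := Subtype.ext hmem
  rw [h1, orderOf_one] at hx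
  exact hp.one_lt.ne hx

theorem card_quotient_lt {N : Subgroup G} (hN : N ≠ ⊥) : Nat.card (G ⧸ N) < Nat.card G := by
  have h1 : 1 < Nat.card N := (Subgroup.one_lt_card_iff_ne_bot N).2 hN
  have h2 : 0 < Nat.card (G ⧸ N) := Nat.card_pos
  have h3 : Nat.card N * Nat.card (G ⧸ N) = Nat.card G := N.card_mul_index
  nlinarith

theorem cyclicBound_of_isSolvable (hG : Group.IsSolvable G) : CyclicBound G := by
  induction hn : Nat.card G using Nat.strong_induction_on generalizing G with
  | _ n ih =>
  subst hn
  cases subsingleton_or_nontrivial G with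
  | inl h =>
    exact ⟨⊥, 1, inferInstance, inferInstance, le_rfl,
      by simpa using coinvariantBound_card G, by simp⟩
  | inr h =>
    by_cases hcyc : ∀ (r : ℕ) (L : Subgroup G), r.Prime → L.Characteristic →
      (∀ x ∈ L, ∀ y ∈ L, x * y = y * x) → (∀ x ∈ L, x ^ r = 1) → IsCyclic L
    · obtain ⟨p, P, hp, hPchar, hPcomm, hPp, hPne⟩ := exists_characteristic_elementary hG
      have := Fact.mk hp
      have hPcyc := hcyc p P hp hPchar hPcomm hPp
      have hcard : Nat.card P = p := by
        have hle : Nat.card P ≤ p :=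
          card_le_of_isCyclic_of_pow_eq_one hp.pos fun x => Subtype.ext (hPp x.1 x.2)
        obtain ⟨k, hk⟩ : ∃ k, Nat.card P = p ^ k :=
          IsPGroup.iff_card.1 fun x => ⟨1, by rw [pow_one]; exact Subtype.ext (hPp x.1 x.2)⟩
        have h1 : 1 < Nat.card P := (Subgroup.one_lt_card_iff_ne_bot P).2 hPne
        refine le_antisymm hle ?_
        rw [hk] at h1 ⊢
        exact Nat.le_self_pow (by rintro rfl; simp at h1) p
      refine cyclicBound_of_prime P hcard hcyc
        (ih _ ?_ inferInstance rfl)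
      refine (card_quotient_lt fun h => hPne ?_).trans_le (Subgroup.card_le_card_group _)
      rw [Subgroup.subgroupOf_eq_bot] at h
      exact disjoint_self.1 (h.mono_right
        (Subgroup.le_centralizer_iff_isMulCommutative.2 ⟨⟨fun x y =>
          Subtype.ext (hPcomm _ x.2 _ y.2)⟩⟩))
    · push Not at hcyc
      obtain ⟨p, L₀, hp, h₀⟩ := hcyc
      have := Fact.mk hp
      let S := {L : Subgroup G // L.Characteristic ∧ (∀ x ∈ L, ∀ y ∈ L, x * y = y * x) ∧
        (∀ x ∈ L, x ^ p = 1) ∧ ¬ IsCyclic L}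
      have : Nonempty S := ⟨⟨L₀, h₀⟩⟩
      obtain ⟨⟨K, hKchar, hKcomm, hKp, hK⟩, hmax⟩ := Finite.exists_max fun L : S => Nat.card L.1
      refine cyclicBound_of_not_isCyclic K hKcomm hKp hK (fun L h1 h2 h3 h4 => ?_)
        (ih _ (card_quotient_lt ?_) inferInstance rfl)
      · have hL : ¬ IsCyclic L := fun hc =>
          hK (isCyclic_of_injective _ (Subgroup.inclusion_injective h4))
        exact (Subgroup.eq_of_le_of_card_ge h4 (hmax ⟨L, h1, h2, h3, hL⟩)).ge
      · rintro rfl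
        exact hK inferInstance

end Induction

end NoetherBound

/-- **Theorem (solvable groups).**  If `C` is a characteristic cyclic subgroup of
maximal order in a finite solvable group `G`, then `β(G) ≤ |C|^0.1 · |G|^0.9`. -/
theorem noetherNumber_le_of_solvable
    (G : Type) [Group G] [Finite G] (hsolv : IsSolvable G)
    (C : Subgroup G) (hchar : C.Characteristic) (hcyc : IsCyclic ↥C)
    (hmax : ∀ D : Subgroup G, D.Characteristic → IsCyclic ↥D →
      Nat.card D ≤ Nat.card C) :
    (noetherNumber G : ℝ) ≤
      (Nat.card C : ℝ) ^ (0.1 : ℝ) * (Nat.card G : ℝ) ^ (0.9 : ℝ) := by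
  obtain ⟨D, d, hDchar, hDcyc, -, hd, hle⟩ := NoetherBound.cyclicBound_of_isSolvable hsolv
  have h1 : (d : ℝ) ^ 10 ≤ (Nat.card C : ℝ) * (Nat.card G : ℝ) ^ 9 := by
    exact_mod_cast hle.trans (Nat.mul_le_mul_right _ (hmax D hDchar hDcyc))
  have h2 : (noetherNumber G : ℝ) ≤ d := by
    exact_mod_cast NoetherBound.noetherNumber_le_of_coinvariantBound hd
  refine h2.trans (le_of_pow_le_pow_left₀ (n := 10) (by norm_num) (by positivity) ?_)
  rw [mul_pow, ← Real.rpow_mul_natCast (by positivity), ← Real.rpow_mul_natCast (by positivity)]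
  norm_num
  exact_mod_cast h1
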